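/- arXiv:2410.20440 — 3 statements merged into one kernel-verified Lean document; each statement's English description precedes it below -/
import Mathlib

section
/- Let A be a left brace of cardinality p^n for a prime p and a natural number n, satisfying Property 2 for a natural number k. Let f : A → A be any function such that p^k·f(a) = a^{∘p^k} for every a ∈ A. Then for all a, b ∈ A one has a − b ∈ ann(p^{2k}) if and only if f(a) − f(b) ∈ ann(p^{2k}); hence the induced map [a] ↦ [f(a)] on A/ann(p^{2k}) is well defined and injective, and since A/ann(p^{2k}) is finite it is a bijection. -/
/-- A left brace: `(A, +)` abelian group, `(A, ∘)` a group (with identity `cone`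
and inverse `cinv`), satisfying `a ∘ (b + c) + a = a ∘ b + a ∘ c`. -/
class LeftBrace (A : Type*) extends AddCommGroup A where
  circ : A → A → A
  cone : A
  cinv : A → A
  circ_assoc : ∀ a b c : A, circ (circ a b) c = circ a (circ b c)
  circ_cone : ∀ a : A, circ a cone = a
  cone_circ : ∀ a : A, circ cone a = a
  circ_cinv : ∀ a : A, circ a (cinv a) = cone
  cinv_circ : ∀ a : A, circ (cinv a) a = cone
  circ_add : ∀ a b c : A, circ a (b + c) + a = circ a b + circ a c

namespace LeftBrace

variable {A : Type*} [LeftBrace A]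

/-- The brace operation `a * b = a ∘ b - a - b`. -/
def bstar (a b : A) : A := circ a b - a - b

/-- `ann (p^i) = {a : p^i • a = 0}`. -/
def ann (p i : ℕ) : Set A := {a : A | (p ^ i : ℕ) • a = 0}

/-- `p^i • A = {p^i • a : a ∈ A}`. -/
def pA (p i : ℕ) : Set A := Set.range (fun a : A => (p ^ i : ℕ) • a)

/-- An ideal of a left brace: an additive subgroup closed under `*` on both sides. -/
def IsIdeal (I : Set A) : Prop :=
  (0 : A) ∈ I ∧ (∀ x ∈ I, ∀ y ∈ I, x + y ∈ I) ∧ (∀ x ∈ I, -x ∈ I) ∧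
  (∀ a : A, ∀ x ∈ I, bstar a x ∈ I) ∧ (∀ a : A, ∀ x ∈ I, bstar x a ∈ I)

/-- `eIter a b m = e'_m(a,b)` for `m ≥ 1`, with `eIter a b 0 = b`;
so `e'_1(a,b) = a * b` and `e'_{m+1}(a,b) = a * e'_m(a,b)`. -/
def eIter (a b : A) : ℕ → A
  | 0 => b
  | m + 1 => bstar a (eIter a b m)

/-- `circPow a j = a^{∘ j}`, the `j`-fold `∘`-product of `a` with itself. -/
def circPow (a : A) : ℕ → A
  | 0 => cone
  | j + 1 => circ a (circPow a j)

/-- Property 1 (with `c = ⌊(p-1)/4⌋`). -/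
def Property1 (p : ℕ) (A : Type*) [LeftBrace A] : Prop :=
  (∀ a b : A, eIter a b ((p - 1) / 4) ∈ pA p 1) ∧
  (∀ i : ℕ, 1 ≤ i → ∀ a : A, ∀ b ∈ ann p i, eIter a b ((p - 1) / 4) ∈ ann p (i - 1))

end LeftBrace

open LeftBrace

/-- Property 2 for the pair `(p, k)`. -/
def Property2 (p k : ℕ) (A : Type*) [LeftBrace A] : Prop :=
  (∀ a b : A, (p ^ (2 * k) : ℕ) • a = (p ^ (2 * k) : ℕ) • b ↔
      (p ^ k : ℕ) • circPow a (p ^ k) = (p ^ k : ℕ) • circPow b (p ^ k)) ∧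
  (∀ i : ℕ, IsIdeal (pA p i : Set A) ∧ IsIdeal (ann p i : Set A)) ∧
  (∀ i j : ℕ, i ≤ j → ∀ x : A, x ∈ pA p i → ∀ y ∈ ann p j, bstar x y ∈ ann p (j - i))

/-- A self-map of a finite type that preserves and reflects the fibres of `φ` meets every fibre. -/
theorem exists_apply_eq_of_apply_eq_iff {α β : Type*} [Finite α] (φ : α → β) (f : α → α)
    (h : ∀ a b, φ a = φ b ↔ φ (f a) = φ (f b)) (b : α) : ∃ a, φ (f a) = φ b := by
  let g : Quotient (Setoid.ker φ) → Quotient (Setoid.ker φ) :=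
    Quotient.map f fun a b hab => (h a b).1 hab
  have hg : Function.Injective g := by
    rintro ⟨a⟩ ⟨b⟩ hab
    exact Quotient.sound ((h a b).2 (Quotient.exact hab))
  obtain ⟨⟨a⟩, ha⟩ := Finite.surjective_of_injective hg (Quotient.mk _ b)
  exact ⟨a, Quotient.exact ha⟩

theorem LeftBrace.sub_mem_ann {A : Type*} [LeftBrace A] {p i : ℕ} {a b : A} :
    a - b ∈ ann p i ↔ (p ^ i : ℕ) • a = (p ^ i : ℕ) • b := by
  rw [ann, Set.mem_ofPred_eq, nsmul_sub, sub_eq_zero]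

theorem statement2 {A : Type*} [LeftBrace A] [Fintype A] (p n k : ℕ) (hp : p.Prime)
    (hcard : Fintype.card A = p ^ n) (hP2 : Property2 p k A)
    (f : A → A) (hf : ∀ a : A, (p ^ k : ℕ) • f a = circPow a (p ^ k)) :
    (∀ a b : A, a - b ∈ ann p (2 * k) ↔ f a - f b ∈ ann p (2 * k)) ∧
    (∀ b : A, ∃ a : A, f a - b ∈ ann p (2 * k)) := by
  have hpow (a : A) : (p ^ (2 * k) : ℕ) • f a = (p ^ k : ℕ) • circPow a (p ^ k) := by
    rw [← hf, smul_smul, ← pow_add, two_mul]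
  have key (a b : A) : (p ^ (2 * k) : ℕ) • a = (p ^ (2 * k) : ℕ) • b ↔
      (p ^ (2 * k) : ℕ) • f a = (p ^ (2 * k) : ℕ) • f b := by
    rw [hpow, hpow, hP2.1]
  simp only [sub_mem_ann]
  exact ⟨key, exists_apply_eq_of_apply_eq_iff (fun a : A => (p ^ (2 * k) : ℕ) • a) f key⟩
end

section
/- Let A be a left brace of cardinality p^n for a prime p > 3 and a natural number n. Assume that for every natural number i, ann(p^i) and p^i·A are ideals of A, and that x * y ∈ ann(p^{j−i}) for all j ≥ i, x ∈ p^i·A and y ∈ ann(p^j). Suppose A satisfies Property 1. Let k be a natural number and let f : A → A satisfy p^k·f(a) = a^{∘p^k} for all a ∈ A. Then the map [a] ↦ [f(a)] on A/ann(p^{2k}) is well defined and injective; that is, for all a, b ∈ A, a − b ∈ ann(p^{2k}) if and only if f(a) − f(b) ∈ ann(p^{2k}). -/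
namespace LeftBrace

variable {A : Type*} [LeftBrace A]

section End

variable {Q : Type*} [AddCommGroup Q]

theorem end_mul_apply (X Y : AddMonoid.End Q) (x : Q) : (X * Y) x = X (Y x) := rfl

theorem end_add_apply (X Y : AddMonoid.End Q) (x : Q) : (X + Y) x = X x + Y x := rfl

theorem end_sum_smul_apply {ι : Type*} (s : Finset ι) (w : ι → ℕ) (X : ι → AddMonoid.End Q)
    (x : Q) : (∑ j ∈ s, w j • X j) x = ∑ j ∈ s, w j • X j x :=
  AddMonoidHom.finsetSum_apply _ _ _

end End

theorem circ_zero (a : A) : circ a 0 = a := by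
  have h := circ_add a 0 0
  rw [add_zero] at h
  exact (add_left_cancel h).symm

theorem cone_eq_zero : (cone : A) = 0 := by
  rw [← circ_zero (cone : A), cone_circ]

theorem circ_add_eq (a x y : A) : circ a (x + y) = circ a x + circ a y - a :=
  eq_sub_of_add_eq (circ_add a x y)

/-- The additive endomorphism `x ↦ a * x`. -/
def starHom (a : A) : AddMonoid.End A :=
  AddMonoidHom.mk' (bstar a) fun x y => by
    simp only [bstar, circ_add_eq]
    abel

theorem starHom_apply (a x : A) : starHom a x = bstar a x := rfl

theorem circ_eq (a x : A) : circ a x = a + x + starHom a x := by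
  rw [starHom_apply, bstar]
  abel

theorem starHom_circ (a b x : A) :
    starHom (circ a b) x = starHom a x + starHom b x + starHom a (starHom b x) := by
  have h := circ_assoc a b x
  rw [circ_eq (circ a b) x, circ_eq b x, circ_add_eq, circ_add_eq, circ_eq a x,
    circ_eq a (starHom b x)] at h
  rw [← sub_eq_zero] at h ⊢
  rw [← h]
  abel

theorem eIter_eq (a b : A) (m : ℕ) : eIter a b m = (starHom a ^ m) b := by
  induction m with
  | zero => rfl
  | succ m ih => rw [pow_succ', end_mul_apply, ← ih]; rfl

/-- The multiplicative group `(A, ∘)` of a left brace. -/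
def CircGroup (A : Type*) : Type _ := A

/-- An element of a left brace, seen in the multiplicative group. -/
def toCircGroup (a : A) : CircGroup A := a

instance : Mul (CircGroup A) := ⟨(circ : A → A → A)⟩

instance : Inv (CircGroup A) := ⟨(cinv : A → A)⟩

instance : One (CircGroup A) := ⟨(cone : A)⟩

instance : Group (CircGroup A) :=
  Group.ofLeftAxioms (circ_assoc (A := A)) (cone_circ (A := A)) (cinv_circ (A := A))

theorem circPow_add (a : A) (m l : ℕ) : circPow a (m + l) = circ (circPow a m) (circPow a l) := by
  induction m with
  | zero => rw [zero_add, circPow, cone_circ]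
  | succ m ih => rw [Nat.add_right_comm, circPow, circPow, ih, circ_assoc]

theorem circPow_one (a : A) : circPow a 1 = a := circ_cone a

theorem circPow_mul (a : A) (m l : ℕ) : circPow a (m * l) = circPow (circPow a m) l := by
  induction l with
  | zero => rfl
  | succ l ih => rw [Nat.mul_succ, add_comm, circPow_add, ih, circPow]

theorem circ_circPow_self (a : A) (m : ℕ) : circ (circPow a m) a = circ a (circPow a m) := by
  have h := circPow_add a m 1
  rwa [circPow_one, circPow, eq_comm] at h

theorem circPow_conj (a b : A) (m : ℕ) :
    circPow (circ (cinv b) (circ a b)) m = circ (cinv b) (circ (circPow a m) b) := by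
  induction m with
  | zero => rw [circPow, circPow, cone_circ, cinv_circ]
  | succ m ih =>
    rw [circPow, circPow, ih, circ_assoc, circ_assoc, circ_assoc, ← circ_assoc b, circ_cinv,
      cone_circ]

theorem circPow_eq_sum (a : A) (m : ℕ) :
    circPow a m = ∑ j ∈ Finset.range m, m.choose (j + 1) • (starHom a ^ j) a := by
  induction m with
  | zero => simp [circPow, cone_eq_zero]
  | succ m ih =>
    have hstar : starHom a (circPow a m) =
        ∑ j ∈ Finset.range m, m.choose (j + 1) • (starHom a ^ (j + 1)) a := by
      rw [ih, map_sum]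
      refine Finset.sum_congr rfl fun j _ => ?_
      rw [map_nsmul, pow_succ', end_mul_apply]
    have hsum : a + starHom a (circPow a m) =
        ∑ j ∈ Finset.range (m + 1), m.choose j • (starHom a ^ j) a := by
      rw [hstar, Finset.sum_range_succ', add_comm]
      simp
    have hpow : circPow a m =
        ∑ j ∈ Finset.range (m + 1), m.choose (j + 1) • (starHom a ^ j) a := by
      rw [Finset.sum_range_succ, ih]
      simp
    rw [circPow, circ_eq, add_right_comm, hsum, hpow, ← Finset.sum_add_distrib]
    refine Finset.sum_congr rfl fun j _ => ?_
    rw [Nat.choose_succ_succ, add_smul]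

/-- The quotient by `p` of the part of `a^{∘p}` with binomial coefficients divisible by `p`. -/
def logPart (p : ℕ) (a : A) : A :=
  ∑ j ∈ Finset.range (p - 1), (p.choose (j + 1) / p) • (starHom a ^ j) a

theorem circPow_prime {p : ℕ} (hp : p.Prime) (a : A) :
    circPow a p = p • logPart p a + (starHom a ^ (p - 1)) a := by
  obtain ⟨q, rfl⟩ : ∃ q, p = q + 1 := ⟨p - 1, (Nat.succ_pred_prime hp).symm⟩
  rw [circPow_eq_sum, Finset.sum_range_succ, logPart, Finset.smul_sum]
  simp only [Nat.add_sub_cancel, Nat.choose_self, one_smul]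
  congr 1
  refine Finset.sum_congr rfl fun j hj => ?_
  rw [smul_smul, Nat.mul_div_cancel']
  exact hp.dvd_choose_self (by omega) (by have := Finset.mem_range.1 hj; omega)

namespace IsIdeal

variable {I : Set A}

/-- The additive subgroup underlying an ideal. -/
def toAddSubgroup (hI : IsIdeal I) : AddSubgroup A where
  carrier := I
  zero_mem' := hI.1
  add_mem' := fun hx hy => hI.2.1 _ hx _ hy
  neg_mem' := fun hx => hI.2.2.1 _ hx

theorem add_mem (hI : IsIdeal I) {x y : A} (hx : x ∈ I) (hy : y ∈ I) : x + y ∈ I :=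
  hI.2.1 x hx y hy

theorem sub_mem (hI : IsIdeal I) {x y : A} (hx : x ∈ I) (hy : y ∈ I) : x - y ∈ I :=
  hI.toAddSubgroup.sub_mem hx hy

theorem starHom_mem (hI : IsIdeal I) (a : A) {x : A} (hx : x ∈ I) : starHom a x ∈ I :=
  hI.2.2.2.1 a x hx

theorem starHom_pow_mem (hI : IsIdeal I) (a : A) {x : A} (hx : x ∈ I) (m : ℕ) :
    (starHom a ^ m) x ∈ I := by
  induction m with
  | zero => exact hx
  | succ m ih =>
    rw [pow_succ', end_mul_apply]
    exact hI.starHom_mem a ih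

theorem circ_sub_circ_left_mem (hI : IsIdeal I) (x : A) {a b : A} (h : a - b ∈ I) :
    circ x a - circ x b ∈ I := by
  have : circ x a - circ x b = (a - b) + starHom x (a - b) := by
    rw [circ_eq, circ_eq, map_sub]
    abel
  rw [this]
  exact hI.add_mem h (hI.starHom_mem x h)

theorem circ_sub_circ_right_mem (hI : IsIdeal I) (x : A) {a b : A} (h : a - b ∈ I) :
    circ a x - circ b x ∈ I := by
  have hd : circ (cinv b) a ∈ I := by
    simpa [cinv_circ, cone_eq_zero] using hI.circ_sub_circ_left_mem (cinv b) h
  have ha : a = circ b (circ (cinv b) a) := by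
    rw [← circ_assoc, circ_cinv, cone_circ]
  rw [ha, circ_assoc]
  apply hI.circ_sub_circ_left_mem
  have : circ (circ (cinv b) a) x - x =
      circ (cinv b) a + bstar (circ (cinv b) a) x := by
    rw [bstar]
    abel
  rw [this]
  exact hI.add_mem hd (hI.2.2.2.2 x _ hd)

theorem starHom_sub_starHom_mem (hI : IsIdeal I) {a b x y : A} (h : a - b ∈ I) (hxy : x - y ∈ I) :
    starHom a x - starHom b y ∈ I := by
  have : starHom a x - starHom b y =
      (circ a x - circ b x) - (a - b) + starHom b (x - y) := by
    rw [circ_eq, circ_eq, map_sub]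
    abel
  rw [this]
  exact hI.add_mem (hI.sub_mem (hI.circ_sub_circ_right_mem x h) h) (hI.starHom_mem b hxy)

theorem starHom_pow_sub_mem (hI : IsIdeal I) {a b x y : A} (h : a - b ∈ I) (hxy : x - y ∈ I)
    (m : ℕ) : (starHom a ^ m) x - (starHom b ^ m) y ∈ I := by
  induction m with
  | zero => exact hxy
  | succ m ih =>
    rw [pow_succ', pow_succ', end_mul_apply, end_mul_apply]
    exact hI.starHom_sub_starHom_mem h ih

theorem logPart_sub_mem (hI : IsIdeal I) (p : ℕ) {a b : A} (h : a - b ∈ I) :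
    logPart p a - logPart p b ∈ I := by
  rw [logPart, logPart, ← Finset.sum_sub_distrib]
  refine hI.toAddSubgroup.sum_mem fun j _ => ?_
  rw [← nsmul_sub]
  exact hI.toAddSubgroup.nsmul_mem (hI.starHom_pow_sub_mem h h j) _

/-- The endomorphism of the additive quotient by an ideal induced by `x ↦ a * x`. -/
def quotientStar (hI : IsIdeal I) (a : A) : AddMonoid.End (A ⧸ hI.toAddSubgroup) :=
  QuotientAddGroup.map hI.toAddSubgroup hI.toAddSubgroup (starHom a)
    fun _ hx => hI.starHom_mem a hx

theorem quotientStar_mk (hI : IsIdeal I) (a x : A) :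
    hI.quotientStar a (x : A ⧸ hI.toAddSubgroup) =
      ((starHom a x : A) : A ⧸ hI.toAddSubgroup) := rfl

theorem quotientStar_pow_mk (hI : IsIdeal I) (a x : A) (m : ℕ) :
    (hI.quotientStar a ^ m) (x : A ⧸ hI.toAddSubgroup) =
      (((starHom a ^ m) x : A) : A ⧸ hI.toAddSubgroup) := by
  induction m with
  | zero => rfl
  | succ m ih =>
    rw [pow_succ', pow_succ', end_mul_apply, end_mul_apply, ih,
      quotientStar_mk]

theorem mk_eq_mk (hI : IsIdeal I) {x y : A} :
    (x : A ⧸ hI.toAddSubgroup) = y ↔ x - y ∈ I :=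
  QuotientAddGroup.eq_iff_sub_mem

theorem commute_quotientStar (hI : IsIdeal I) {a b : A} (h : circ a b - circ b a ∈ I) :
    Commute (hI.quotientStar a) (hI.quotientStar b) := by
  ext x
  obtain ⟨x, rfl⟩ := QuotientAddGroup.mk_surjective x
  change ((starHom a (starHom b x) : A) : A ⧸ hI.toAddSubgroup) =
    ((starHom b (starHom a x) : A) : A ⧸ hI.toAddSubgroup)
  rw [hI.mk_eq_mk]
  have hx := hI.starHom_sub_starHom_mem (x := x) (y := x) h (by simpa using hI.1)
  rw [starHom_circ, starHom_circ] at hx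
  convert hx using 1
  abel

end IsIdeal

theorem pow_apply_sub_pow_apply {Q : Type*} [AddCommGroup Q] {X Y : AddMonoid.End Q}
    (hXY : Commute X Y) {α β : Q} (h : X β = Y α) (j : ℕ) :
    (X ^ j) α - (Y ^ j) β = (∑ r ∈ Finset.range (j + 1), X ^ r * Y ^ (j - r)) (α - β) := by
  induction j with
  | zero => simp
  | succ j ih =>
    have hsum : ∑ r ∈ Finset.range (j + 1 + 1), X ^ r * Y ^ (j + 1 - r) =
        X * (∑ r ∈ Finset.range (j + 1), X ^ r * Y ^ (j - r)) + Y ^ (j + 1) := by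
      rw [Finset.sum_range_succ', Finset.mul_sum]
      simp [pow_succ', mul_assoc]
    have hcomm : X ((Y ^ j) β) = (Y ^ (j + 1)) α := by
      rw [← end_mul_apply, (hXY.pow_right j).eq, end_mul_apply, h,
        ← end_mul_apply, ← pow_succ]
    have hX : (X ^ (j + 1)) α = X ((X ^ j) α) := by
      rw [pow_succ', end_mul_apply]
    rw [hsum, end_add_apply, end_mul_apply, ← ih, map_sub, map_sub, hcomm, hX]
    abel

theorem IsIdeal.sub_mem_of_logPart_sub_mem {I : Set A} (hI : IsIdeal I) {p : ℕ} (hp : p.Prime)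
    (hnil : ∀ a : A, IsNilpotent (starHom a)) {a b : A} (hab : circ a b - circ b a ∈ I)
    (h : logPart p a - logPart p b ∈ I) : a - b ∈ I := by
  set X := hI.quotientStar a with hX
  set Y := hI.quotientStar b with hY
  have hXY : Commute X Y := hI.commute_quotientStar hab
  have hnilQ : ∀ a : A, IsNilpotent (hI.quotientStar a) := fun a => by
    obtain ⟨m, hm⟩ := hnil a
    refine ⟨m, ?_⟩
    ext x
    obtain ⟨x, rfl⟩ := QuotientAddGroup.mk_surjective x
    change (hI.quotientStar a ^ m) (x : A ⧸ hI.toAddSubgroup) = 0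
    rw [hI.quotientStar_pow_mk, hm]
    rfl
  have hXb : X (b : A ⧸ hI.toAddSubgroup) = Y (a : A ⧸ hI.toAddSubgroup) := by
    rw [hX, hY, hI.quotientStar_mk, hI.quotientStar_mk, hI.mk_eq_mk]
    rw [circ_eq, circ_eq] at hab
    convert hab using 1
    abel
  set D : ℕ → AddMonoid.End (A ⧸ hI.toAddSubgroup) :=
    fun j => ∑ r ∈ Finset.range (j + 1), X ^ r * Y ^ (j - r) with hD
  set w : ℕ → ℕ := fun j => p.choose (j + 1) / p with hw
  have hcommX : ∀ j, Commute X (D j) := fun j =>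
    Commute.sum_right _ _ _ fun r _ => ((Commute.refl X).pow_right r).mul_right (hXY.pow_right _)
  have hcommY : ∀ j, Commute Y (D j) := fun j =>
    Commute.sum_right _ _ _ fun r _ =>
      (hXY.symm.pow_right r).mul_right ((Commute.refl Y).pow_right _)
  have hcommD : ∀ i j, Commute (D i) (D j) := fun i j =>
    Commute.sum_left _ _ _ fun r _ => ((hcommX j).pow_left r).mul_left ((hcommY j).pow_left _)
  have hnilD : ∀ j, IsNilpotent (D (j + 1)) := fun j => by
    have hsucc : D (j + 1) = X * D j + Y * Y ^ j := by
      simp only [hD]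
      rw [Finset.sum_range_succ', Finset.mul_sum]
      simp [pow_succ', mul_assoc]
    rw [hsucc]
    refine Commute.isNilpotent_add ?_ ((hcommX j).isNilpotent_mul_right (hnilQ a))
      (((Commute.refl Y).pow_right j).isNilpotent_mul_right (hnilQ b))
    have hY' : Commute (X * D j) Y := hXY.mul_left (hcommY j).symm
    exact hY'.mul_right (hY'.pow_right j)
  obtain ⟨q, hq⟩ : ∃ q, p - 1 = q + 1 := ⟨p - 2, by have := hp.two_le; omega⟩
  have hunit : IsUnit (∑ j ∈ Finset.range (p - 1), w j • D j) := by
    rw [hq, Finset.sum_range_succ']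
    have h0 : w 0 • D 0 = 1 := by
      simp [hw, hD, Nat.div_self hp.pos]
    rw [h0]
    apply IsNilpotent.isUnit_add_one
    refine Commute.isNilpotent_sum (fun j _ => ?_) fun i j _ _ => ?_
    · exact (hnilD j).smul (w (j + 1))
    · exact ((hcommD _ _).smul_left _).smul_right _
  have hzero : (∑ j ∈ Finset.range (p - 1), w j • D j)
      ((a : A ⧸ hI.toAddSubgroup) - (b : A ⧸ hI.toAddSubgroup)) = 0 := by
    have hmk := hI.mk_eq_mk.2 h
    rw [← sub_eq_zero] at hmk
    rw [← hmk, logPart, logPart]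
    change _ = QuotientAddGroup.mk' hI.toAddSubgroup _ - QuotientAddGroup.mk' hI.toAddSubgroup _
    rw [map_sum, map_sum, ← Finset.sum_sub_distrib, end_sum_smul_apply]
    refine Finset.sum_congr rfl fun j _ => ?_
    rw [map_nsmul, map_nsmul, ← nsmul_sub]
    congr 1
    rw [← pow_apply_sub_pow_apply hXY hXb, hX, hY, hI.quotientStar_pow_mk, hI.quotientStar_pow_mk]
    rfl
  obtain ⟨u, hu⟩ := hunit
  rw [← hu] at hzero
  have := congrArg (↑u⁻¹ : AddMonoid.End (A ⧸ hI.toAddSubgroup)) hzero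
  rw [← end_mul_apply, Units.inv_mul, map_zero] at this
  exact hI.mk_eq_mk.1 (sub_eq_zero.1 this)

section Annihilators

variable {p : ℕ}

theorem smul_mem_ann_iff (x : A) (i k : ℕ) : p ^ k • x ∈ (ann p i : Set A) ↔ x ∈ ann p (i + k) := by
  simp only [ann, Set.mem_ofPred_eq, smul_smul, pow_add]

theorem ann_mono {i j : ℕ} (h : i ≤ j) : (ann p i : Set A) ⊆ ann p j := by
  intro x hx
  simp only [ann, Set.mem_ofPred_eq] at hx ⊢
  rw [← Nat.sub_add_cancel h, pow_add, mul_smul, hx, smul_zero]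

variable (hI : ∀ i : ℕ, IsIdeal (ann p i : Set A)) (hP : Property1 p A)

include hI hP in
theorem starHom_pow_mem_ann (a : A) {x : A} {i t m : ℕ} (hx : x ∈ ann p (i + t))
    (hm : t * ((p - 1) / 4) ≤ m) : (starHom a ^ m) x ∈ ann p i := by
  induction t generalizing x m with
  | zero => exact (hI i).starHom_pow_mem a hx m
  | succ t ih =>
    have h := hP.2 (i + (t + 1)) (by omega) a x hx
    rw [eIter_eq] at h
    rw [Nat.succ_mul] at hm
    rw [← Nat.sub_add_cancel (le_of_add_le_right hm), pow_add, end_mul_apply]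
    exact ih h (Nat.le_sub_of_add_le hm)

include hI hP in
theorem isNilpotent_starHom {n : ℕ} (hn : ∀ x : A, p ^ n • x = 0) (a : A) :
    IsNilpotent (starHom a) := by
  refine ⟨n * ((p - 1) / 4), ?_⟩
  ext x
  have hx : x ∈ (ann p (0 + n) : Set A) := by
    simpa [ann] using hn x
  simpa [ann] using starHom_pow_mem_ann hI hP a hx le_rfl

include hI hP in
theorem starHom_pow_sub_mem_ann {a b : A} {i t m : ℕ} (hab : a - b ∈ (ann p (i + t) : Set A))
    (hm : 2 * t * ((p - 1) / 4) ≤ m) (x : A) :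
    (starHom a ^ m) x - (starHom b ^ m) x ∈ (ann p i : Set A) := by
  induction t generalizing i m x with
  | zero => exact (hI i).starHom_pow_sub_mem hab (by simpa using (hI i).1) m
  | succ t ih =>
    generalize hc : (p - 1) / 4 = c at *
    obtain ⟨m, rfl⟩ : ∃ l, m = l + c := ⟨m - c, by
      rw [Nat.sub_add_cancel]
      nlinarith⟩
    obtain ⟨y, hy⟩ := hP.1 b x
    rw [eIter_eq, hc] at hy
    change p ^ 1 • y = _ at hy
    have h1 : (starHom a ^ m) ((starHom a ^ c) x - (starHom b ^ c) x) ∈ (ann p i : Set A) :=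
      starHom_pow_mem_ann hI hP a
        ((hI _).starHom_pow_sub_mem hab (by simpa using (hI _).1) c) (by rw [hc]; nlinarith)
    have h2 : p ^ 1 • ((starHom a ^ m) y - (starHom b ^ m) y) ∈ (ann p i : Set A) := by
      rw [smul_mem_ann_iff]
      exact ih (by rwa [add_assoc, add_comm 1 t]) (by nlinarith) y
    have : (starHom a ^ (m + c)) x - (starHom b ^ (m + c)) x =
        (starHom a ^ m) ((starHom a ^ c) x - (starHom b ^ c) x) +
          p ^ 1 • ((starHom a ^ m) y - (starHom b ^ m) y) := by
      rw [pow_add, pow_add, end_mul_apply, end_mul_apply, map_sub, ← hy,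
        nsmul_sub, ← map_nsmul, ← map_nsmul]
      abel
    rw [this]
    exact (hI i).add_mem h1 h2

include hI hP in
theorem starHom_pow_self_sub_mem_ann {a b : A} {i t : ℕ} (ht : t ≤ 2)
    (hab : a - b ∈ (ann p (i + t) : Set A)) :
    (starHom a ^ (p - 1)) a - (starHom b ^ (p - 1)) b ∈ (ann p i : Set A) := by
  have hc : 4 * ((p - 1) / 4) ≤ p - 1 := Nat.mul_div_le _ _
  have : (starHom a ^ (p - 1)) a - (starHom b ^ (p - 1)) b =
      (starHom a ^ (p - 1)) (a - b) + ((starHom a ^ (p - 1)) b - (starHom b ^ (p - 1)) b) := by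
    rw [map_sub]
    abel
  rw [this]
  exact (hI i).add_mem (starHom_pow_mem_ann hI hP a hab (by nlinarith))
    (starHom_pow_sub_mem_ann hI hP hab (by nlinarith) b)

theorem circPow_prime_sub (hp : p.Prime) (a b : A) :
    circPow a p - circPow b p = p ^ 1 • (logPart p a - logPart p b) +
      ((starHom a ^ (p - 1)) a - (starHom b ^ (p - 1)) b) := by
  rw [circPow_prime hp, circPow_prime hp, pow_one, nsmul_sub]
  abel

include hI hP in
theorem circPow_prime_sub_mem_ann (hp : p.Prime) {a b : A} {i : ℕ}
    (hab : a - b ∈ (ann p (i + 1) : Set A)) : circPow a p - circPow b p ∈ (ann p i : Set A) := by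
  rw [circPow_prime_sub hp]
  refine (hI i).add_mem ?_ (starHom_pow_self_sub_mem_ann hI hP one_le_two hab)
  rw [smul_mem_ann_iff]
  exact (hI _).logPart_sub_mem p hab

include hI hP in
theorem sub_mem_ann_of_circ_sub_circ_mem (hp : p.Prime) {n : ℕ} (hn : ∀ x : A, p ^ n • x = 0)
    {a b : A} {i : ℕ} (hcomm : circ a b - circ b a ∈ (ann p (i + 1) : Set A))
    (h : circPow a p - circPow b p ∈ (ann p i : Set A)) : a - b ∈ (ann p (i + 1) : Set A) := by
  have hdesc : ∀ t, a - b ∈ (ann p (i + 1 + t) : Set A) → a - b ∈ (ann p (i + 1) : Set A) := by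
    intro t
    induction t with
    | zero => exact id
    | succ t ih =>
      intro ht
      apply ih
      refine (hI _).sub_mem_of_logPart_sub_mem hp (isNilpotent_starHom hI hP hn)
        (ann_mono (Nat.le_add_right _ _) hcomm) ?_
      have hlast : (starHom a ^ (p - 1)) a - (starHom b ^ (p - 1)) b ∈ (ann p (i + t) : Set A) :=
        starHom_pow_self_sub_mem_ann hI hP le_rfl
          (by rwa [show i + t + 2 = i + 1 + (t + 1) by ring])
      have hdiff := (hI _).sub_mem (ann_mono (Nat.le_add_right i t) h) hlast
      rw [circPow_prime_sub hp, add_sub_cancel_right, smul_mem_ann_iff] at hdiff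
      rwa [add_right_comm]
  refine hdesc n (ann_mono (Nat.le_add_left n _) ?_)
  simpa [ann] using hn (a - b)

include hI hP in
theorem sub_mem_ann_of_mem_upperCentralSeries (hp : p.Prime) {n : ℕ}
    (hn : ∀ x : A, p ^ n • x = 0) {i : ℕ} (r : ℕ) (a b : A)
    (hr : (toCircGroup a)⁻¹ * toCircGroup b ∈ Subgroup.upperCentralSeries (CircGroup A) r)
    (h : circPow a p - circPow b p ∈ (ann p i : Set A)) :
    a - b ∈ (ann p (i + 1) : Set A) := by
  induction r generalizing a b with
  | zero =>
    rw [Subgroup.upperCentralSeries_zero, Subgroup.mem_bot, inv_mul_eq_one] at hr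
    have hab : a = b := hr
    rw [hab, sub_self]
    exact (hI _).1
  | succ r ih =>
    have hmem : (toCircGroup a)⁻¹ * toCircGroup (circ (cinv b) (circ a b)) ∈
        Subgroup.upperCentralSeries (CircGroup A) r := by
      have hz := Subgroup.mem_upperCentralSeries_succ_iff.1 (inv_mem hr) (toCircGroup a)⁻¹
      change (toCircGroup a)⁻¹ * ((toCircGroup b)⁻¹ * (toCircGroup a * toCircGroup b)) ∈ _
      convert inv_mem hz using 1
      group
    have hpow : circPow a p - circPow (circ (cinv b) (circ a b)) p ∈ (ann p i : Set A) := by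
      have hl := (hI i).circ_sub_circ_left_mem b h
      have hr := (hI i).circ_sub_circ_right_mem b h
      rw [circ_circPow_self] at hr
      have hlr := (hI i).sub_mem hl hr
      rw [sub_sub_sub_cancel_right] at hlr
      replace hlr := (hI i).circ_sub_circ_left_mem (cinv b) hlr
      rwa [← circ_assoc, cinv_circ, cone_circ, ← circPow_conj] at hlr
    have hconj := (hI _).circ_sub_circ_left_mem b (ih a _ hmem hpow)
    rw [← circ_assoc b (cinv b), circ_cinv, cone_circ] at hconj
    refine sub_mem_ann_of_circ_sub_circ_mem hI hP hp hn ?_ h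
    rw [← neg_sub]
    exact (hI _).2.2.1 _ hconj

include hI hP in
theorem circPow_prime_pow_sub_mem_ann_iff [Finite A] (hp : p.Prime) {n : ℕ}
    (hcard : Nat.card A = p ^ n) (k i : ℕ) (a b : A) :
    circPow a (p ^ k) - circPow b (p ^ k) ∈ (ann p i : Set A) ↔
      a - b ∈ (ann p (i + k) : Set A) := by
  induction k generalizing a b i with
  | zero => simp [circPow, circ_cone]
  | succ k ih =>
    have : Fact p.Prime := ⟨hp⟩
    have : Finite (CircGroup A) := inferInstanceAs (Finite A)
    have hnil : Group.IsNilpotent (CircGroup A) :=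
      (IsPGroup.of_card (p := p) (G := CircGroup A) hcard).isNilpotent
    obtain ⟨r, hr⟩ := hnil.nilpotent
    have hn : ∀ x : A, p ^ n • x = 0 := fun x => by
      rw [← hcard]
      exact card_nsmul_eq_zero'
    rw [pow_succ', circPow_mul, circPow_mul, ih, ← add_assoc]
    refine ⟨fun h => ?_, fun h => circPow_prime_sub_mem_ann hI hP hp h⟩
    refine sub_mem_ann_of_mem_upperCentralSeries hI hP hp hn r a b ?_ h
    rw [hr]
    exact Subgroup.mem_top _

end Annihilators

end LeftBrace

open LeftBrace

theorem statement7 {A : Type*} [LeftBrace A] [Fintype A] (p n k : ℕ) (hp : p.Prime)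
    (hp3 : 3 < p) (hcard : Fintype.card A = p ^ n)
    (hid : ∀ i : ℕ, IsIdeal (ann p i : Set A) ∧ IsIdeal (pA p i : Set A))
    (hstar : ∀ i j : ℕ, i ≤ j → ∀ x : A, x ∈ pA p i → ∀ y ∈ ann p j,
      bstar x y ∈ ann p (j - i))
    (hP1 : Property1 p A)
    (f : A → A) (hf : ∀ a : A, (p ^ k : ℕ) • f a = circPow a (p ^ k)) :
    ∀ a b : A, a - b ∈ ann p (2 * k) ↔ f a - f b ∈ ann p (2 * k) := by
  intro a b
  rw [two_mul, ← circPow_prime_pow_sub_mem_ann_iff (fun i => (hid i).1) hP1 hp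
    (by rw [Nat.card_eq_fintype_card, hcard]) k k a b, ← hf, ← hf, ← nsmul_sub, smul_mem_ann_iff]
end

section
/- Let (A, +, ·) be a pre-Lie ring of cardinality p^n for a prime p > 3 and a natural number n, satisfying Property 3, and let ρ, s_j, γ_j, σ_j, η_j, L_a, E_j and W be as in the context. Then the map W : A → A, W(a) = Σ_{j≥1} σ_j·E_j(a), is injective, hence bijective, and its inverse Ω satisfies Ω = W^{(p^{n+1}! − 1)} (the (p^{n+1}! − 1)-fold iterate of W). -/
/-- A pre-Lie ring: an abelian group with a bi-additive multiplication satisfying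
`(x·y)·z − x·(y·z) = (y·x)·z − y·(x·z)`. -/
class PreLieRing (A : Type*) extends AddCommGroup A where
  mul : A → A → A
  add_mul' : ∀ a b c : A, mul (a + b) c = mul a c + mul b c
  mul_add' : ∀ a b c : A, mul a (b + c) = mul a b + mul a c
  pre_lie : ∀ x y z : A,
    mul (mul x y) z - mul x (mul y z) = mul (mul y x) z - mul y (mul x z)

namespace PreLieRing

variable {A : Type*} [PreLieRing A]

/-- `ann (p^i) = {a : p^i • a = 0}`. -/
def ann (p i : ℕ) : Set A := {a : A | (p ^ i : ℕ) • a = 0}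

/-- `p^i • A = {p^i • a : a ∈ A}`. -/
def pA (p i : ℕ) : Set A := Set.range (fun a : A => (p ^ i : ℕ) • a)

/-- Nested left-normed product `a₁ · (a₂ · (⋯ · (aₘ · b)⋯))`. -/
def nestedMul : List A → A → A
  | [], b => b
  | a :: l, b => mul a (nestedMul l b)

/-- `Lpow a m x = L_a^m(x)`, the `m`-fold left multiplication by `a`. -/
def Lpow (a : A) (m : ℕ) (x : A) : A := (fun y => mul a y)^[m] x

/-- Property 3 (with `c = ⌊(p-1)/4⌋`): products of `c` elements lie in `p·A`, and
products of `c` elements applied to `ann(pⁱ)` lie in `p·ann(pⁱ)`. -/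
def Property3 (p : ℕ) (A : Type*) [PreLieRing A] : Prop :=
  (∀ (l : List A) (b : A), l.length + 1 = (p - 1) / 4 → nestedMul l b ∈ pA p 1) ∧
  (∀ i : ℕ, 1 ≤ i → ∀ l : List A, l.length = (p - 1) / 4 →
    ∀ b ∈ ann p i, ∃ y ∈ ann p i, nestedMul l b = p • y)

end PreLieRing

namespace PreLieRing

variable {A : Type*} [PreLieRing A]

/-- `sVal p j = s_j`, the largest `s` with `p^s ∣ j!`. -/
def sVal (p j : ℕ) : ℕ := (Nat.factorial j).factorization p

/-- `etaVal p j = η_j = ⌊(p-1)/4⌋ · s_j`. -/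
def etaVal (p j : ℕ) : ℕ := ((p - 1) / 4) * sVal p j

/-- `Ediag p ρ a j = E_j(a)`:
`E_j(a) = L_a^{j-η_j}(ρ^{s_j}(L_a^{η_j−1}(a)))` if `η_j ≥ 1`, and
`E_j(a) = L_a^{j-1}(a)` if `η_j = 0` (with the junk value `0` for `j = 0`). -/
noncomputable def Ediag (p : ℕ) (ρ : A → A) (a : A) (j : ℕ) : A :=
  if j = 0 then 0
  else if etaVal p j = 0 then Lpow a (j - 1) a
  else Lpow a (j - etaVal p j) (ρ^[sVal p j] (Lpow a (etaVal p j - 1) a))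

/-- `Eop p ρ a j b = E_{j,a}(b) = L_a^{j-η_j}(ρ^{s_j}(L_a^{η_j}(b)))`
(with the junk value `0` for `j = 0`). -/
noncomputable def Eop (p : ℕ) (ρ : A → A) (a : A) (j : ℕ) (b : A) : A :=
  if j = 0 then 0
  else Lpow a (j - etaVal p j) (ρ^[sVal p j] (Lpow a (etaVal p j) b))

/-- `Wmap p σ ρ a = W(a) = Σ_{j ≥ 1} σ_j • E_j(a)` (a finite sum, as all but
finitely many terms vanish). -/
noncomputable def Wmap (p : ℕ) (σ : ℕ → ℤ) (ρ : A → A) (a : A) : A :=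
  ∑ᶠ j : ℕ, σ j • Ediag p ρ a j

/-- `Wop p σ ρ a b = W(a, b) = Σ_{j ≥ 1} σ_j • E_{j,a}(b)` (a finite sum). -/
noncomputable def Wop (p : ℕ) (σ : ℕ → ℤ) (ρ : A → A) (a b : A) : A :=
  ∑ᶠ j : ℕ, σ j • Eop p ρ a j b

end PreLieRing

open Finset Polynomial in
/-- The exponential series truncated before degree `c`. -/
noncomputable def truncExp (K : Type*) {R : Type*} [Field K] [Ring R] [Algebra K R] (c : ℕ)
    (x : R) : R :=
  ∑ j ∈ range c, ((j.factorial : ℕ) : K)⁻¹ • x ^ j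

namespace TruncExp

open Finset Polynomial

section Conjugation

variable {K R : Type*} [Field K] [Ring R] [Algebra K R] {c : ℕ}

/-- The `j`-th term of the exponential series. -/
noncomputable def expTerm (K : Type*) {R : Type*} [Field K] [Ring R] [Algebra K R] (j : ℕ)
    (x : R) : R :=
  ((j.factorial : ℕ) : K)⁻¹ • x ^ j

theorem expTerm_zero (x : R) : expTerm K 0 x = 1 := by simp [expTerm]

theorem succ_smul_expTerm (hK : ∀ m : ℕ, 0 < m → m < c → (m : K) ≠ 0) {x : R} (hx : x ^ c = 0)
    (j : ℕ) : ((j + 1 : ℕ) : K) • expTerm K (j + 1) x = x * expTerm K j x := by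
  unfold expTerm
  rw [mul_smul_comm, ← pow_succ']
  rcases lt_or_ge (j + 1) c with h | h
  · have := hK (j + 1) (by omega) h
    rw [smul_smul, Nat.factorial_succ, Nat.cast_mul, mul_inv, ← mul_assoc, mul_inv_cancel₀ this,
      one_mul]
  · rw [pow_eq_zero_of_le h hx, smul_zero, smul_zero, smul_zero]

theorem expTerm_mul_comm (j : ℕ) (x : R) : x * expTerm K j x = expTerm K j x * x := by
  unfold expTerm
  rw [mul_smul_comm, smul_mul_assoc, (Commute.self_pow x j).eq]

/-- The part of total degree `k` of `exp (-z) * D (exp z)`. -/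
noncomputable def conjTerm (D : R →ₗ[K] R) (z : R) (k : ℕ) : R :=
  ∑ ij ∈ antidiagonal k, expTerm K ij.1 (-z) * D (expTerm K ij.2 z)

theorem conjTerm_zero (D : R →ₗ[K] R) (z : R) : conjTerm D z 0 = D 1 := by
  simp [conjTerm, expTerm_zero]

theorem succ_smul_conjTerm (hK : ∀ m : ℕ, 0 < m → m < c → (m : K) ≠ 0) {z : R} (hz : z ^ c = 0)
    (D : R →ₗ[K] R) (w : R) (hD : ∀ x, D (x * z) = D x * z + x * w) (k : ℕ) :
    ((k + 1 : ℕ) : K) • conjTerm D z (k + 1) =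
      conjTerm D z k * z - z * conjTerm D z k + conjTerm (LinearMap.id : R →ₗ[K] R) z k * w := by
  have hz' : (-z) ^ c = 0 := by rw [neg_pow, hz, mul_zero]
  have h1 : ((k + 1 : ℕ) : K) • conjTerm D z (k + 1) =
      ∑ ij ∈ antidiagonal (k + 1), ((ij.1 : K) • expTerm K ij.1 (-z)) * D (expTerm K ij.2 z) +
      ∑ ij ∈ antidiagonal (k + 1), expTerm K ij.1 (-z) * D ((ij.2 : K) • expTerm K ij.2 z) := by
    rw [conjTerm, smul_sum, ← sum_add_distrib]
    refine sum_congr rfl fun ij h => ?_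
    rw [← HasAntidiagonal.mem_antidiagonal.1 h, Nat.cast_add, add_smul, smul_mul_assoc, map_smul,
      mul_smul_comm]
  rw [h1, Finset.Nat.sum_antidiagonal_succ, Finset.Nat.sum_antidiagonal_succ']
  simp only [Nat.cast_zero, zero_smul, zero_mul, map_zero, mul_zero, zero_add,
    succ_smul_expTerm hK hz, succ_smul_expTerm hK hz']
  simp only [expTerm_mul_comm, hD, conjTerm, mul_sum, sum_mul, ← sum_add_distrib,
    ← sum_sub_distrib, LinearMap.id_apply]
  refine sum_congr rfl fun ij _ => ?_
  rw [← expTerm_mul_comm]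
  noncomm_ring

theorem conjTerm_id (hK : ∀ m : ℕ, 0 < m → m < c → (m : K) ≠ 0) {z : R} (hz : z ^ c = 0) {k : ℕ}
    (hk : k + 1 < c) : conjTerm (LinearMap.id : R →ₗ[K] R) z (k + 1) = 0 := by
  have key : ∀ k, k + 1 < c →
      conjTerm (LinearMap.id : R →ₗ[K] R) z k * z = z * conjTerm (LinearMap.id : R →ₗ[K] R) z k →
      conjTerm (LinearMap.id : R →ₗ[K] R) z (k + 1) = 0 := by
    intro k hk h
    have := succ_smul_conjTerm hK hz LinearMap.id 0 (by simp) k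
    rw [h, sub_self, mul_zero, add_zero] at this
    exact (smul_eq_zero.1 this).resolve_left (hK _ (by omega) hk)
  induction k with
  | zero => exact key 0 hk (by simp [conjTerm_zero])
  | succ k ih => exact key _ hk (by simp [ih (by omega)])

theorem truncExp_neg_mul {z : R} (D : R →ₗ[K] R)
    (hvan : ∀ i j, c ≤ i + j → z ^ i * D (z ^ j) = 0) :
    truncExp K c (-z) * D (truncExp K c z) = ∑ k ∈ range c, conjTerm D z k := by
  have hterm : ∀ i j, c ≤ i + j → expTerm K i (-z) * D (expTerm K j z) = 0 := by
    intro i j h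
    simp only [expTerm, map_smul, smul_mul_assoc, mul_smul_comm, neg_pow z i, mul_assoc, hvan i j h,
      mul_zero, smul_zero]
  have h1 : truncExp K c (-z) * D (truncExp K c z) =
      ∑ ij ∈ range c ×ˢ range c, expTerm K ij.1 (-z) * D (expTerm K ij.2 z) := by
    simp only [truncExp, map_sum, sum_mul_sum, sum_product, expTerm]
  have h2 : ∑ k ∈ range c, conjTerm D z k =
      ∑ ij ∈ (range c ×ˢ range c).filter (fun ij => ij.1 + ij.2 < c),
        expTerm K ij.1 (-z) * D (expTerm K ij.2 z) := by
    simp only [conjTerm]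
    rw [← sum_fiberwise_of_maps_to (t := range c) (g := fun ij : ℕ × ℕ => ij.1 + ij.2)
      (fun ij h => by simpa using (mem_filter.1 h).2)]
    refine sum_congr rfl fun k hk => sum_congr ?_ fun _ _ => rfl
    ext ⟨i, j⟩
    simp only [HasAntidiagonal.mem_antidiagonal, mem_filter, mem_product, mem_range] at hk ⊢
    omega
  rw [h1, h2, sum_filter]
  refine sum_congr rfl fun ij _ => ?_
  split_ifs with h
  · rfl
  · exact hterm _ _ (by omega)

theorem truncExp_neg_mul_self (hK : ∀ m : ℕ, 0 < m → m < c → (m : K) ≠ 0) (hc : 0 < c) {z : R}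
    (hz : z ^ c = 0) : truncExp K c (-z) * truncExp K c z = 1 := by
  have h := truncExp_neg_mul (c := c) (z := z) (LinearMap.id : R →ₗ[K] R) (fun i j hij => by
    rw [LinearMap.id_apply, ← pow_add, pow_eq_zero_of_le hij hz])
  rw [LinearMap.id_apply] at h
  rw [h, sum_eq_single_of_mem 0 (mem_range.2 hc), conjTerm_zero, LinearMap.id_apply]
  intro k hk hk0
  obtain ⟨k, rfl⟩ := Nat.exists_eq_succ_of_ne_zero hk0
  exact conjTerm_id hK hz (mem_range.1 hk)

theorem truncExp_mul_neg_self (hK : ∀ m : ℕ, 0 < m → m < c → (m : K) ≠ 0) (hc : 0 < c) {z : R}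
    (hz : z ^ c = 0) : truncExp K c z * truncExp K c (-z) = 1 := by
  have h := truncExp_neg_mul_self (z := -z) hK hc (by rw [neg_pow, hz, mul_zero])
  rwa [neg_neg] at h

/-- If `D` is, up to `w ∈ L`, right linear over `z ∈ L`, then `exp (-z) * D (exp z)` lies in the
Lie subalgebra `L`, provided `D 1` does. -/
theorem truncExp_neg_mul_mem (hK : ∀ m : ℕ, 0 < m → m < c → (m : K) ≠ 0) {L : Submodule K R}
    (hL : ∀ x ∈ L, ∀ y ∈ L, x * y - y * x ∈ L) {z w : R} (hzL : z ∈ L) (hz : z ^ c = 0)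
    (hw : w ∈ L) (D : R →ₗ[K] R) (hD : ∀ x, D (x * z) = D x * z + x * w) (hD1 : D 1 ∈ L)
    (hvan : ∀ i j, c ≤ i + j → z ^ i * D (z ^ j) = 0) :
    truncExp K c (-z) * D (truncExp K c z) ∈ L := by
  rw [truncExp_neg_mul D hvan]
  have key : ∀ k, k < c → conjTerm D z k ∈ L := by
    intro k
    induction k with
    | zero => intro _; rwa [conjTerm_zero]
    | succ k ih =>
      intro hk
      have h := succ_smul_conjTerm hK hz D w hD k
      have hmem : ((k + 1 : ℕ) : K) • conjTerm D z (k + 1) ∈ L := by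
        rw [h]
        refine add_mem (hL _ (ih (by omega)) _ hzL) ?_
        rcases k with _ | k
        · simpa [conjTerm_zero] using hw
        · rw [conjTerm_id hK hz (by omega), zero_mul]
          exact zero_mem _
      exact (Submodule.smul_mem_iff _ (hK _ (by omega) hk)).1 hmem
  exact sum_mem fun k hk => key k (mem_range.1 hk)

end Conjugation

section Rees

variable {K E : Type*} [Field K] [Ring E] [Algebra K E] {g : Submodule K E} {c : ℕ}

/-- The polynomials divisible by `X ^ k` whose `m`-th coefficient lies in `g ^ m`. -/
def reesFilt (g : Submodule K E) (k : ℕ) : Submodule K E[X] where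
  carrier := {f | ∀ m, f.coeff m ∈ g ^ m ∧ (m < k → f.coeff m = 0)}
  add_mem' {f h} hf hh m := by
    refine ⟨by rw [coeff_add]; exact add_mem (hf m).1 (hh m).1, fun hm => ?_⟩
    rw [coeff_add, (hf m).2 hm, (hh m).2 hm, add_zero]
  zero_mem' m := by simp
  smul_mem' r f hf m := by
    refine ⟨by rw [coeff_smul]; exact Submodule.smul_mem _ _ (hf m).1, fun hm => ?_⟩
    rw [coeff_smul, (hf m).2 hm, smul_zero]

theorem mul_mem_reesFilt {k l : ℕ} {f h : E[X]} (hf : f ∈ reesFilt g k) (hh : h ∈ reesFilt g l) :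
    f * h ∈ reesFilt g (k + l) := by
  intro m
  rw [coeff_mul]
  constructor
  · refine sum_mem fun ij hij => ?_
    rw [← HasAntidiagonal.mem_antidiagonal.1 hij, pow_add]
    exact Submodule.mul_mem_mul (hf _).1 (hh _).1
  · intro hm
    refine sum_eq_zero fun ij hij => ?_
    have := HasAntidiagonal.mem_antidiagonal.1 hij
    rcases lt_or_ge ij.1 k with h1 | h1
    · rw [(hf _).2 h1, zero_mul]
    · rw [(hh _).2 (by omega), mul_zero]

theorem reesFilt_mono {k l : ℕ} (hkl : k ≤ l) : reesFilt g l ≤ reesFilt g k :=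
  fun _ hf m => ⟨(hf m).1, fun hm => (hf m).2 (hm.trans_le hkl)⟩

theorem one_mem_reesFilt : (1 : E[X]) ∈ reesFilt g 0 := by
  intro m
  refine ⟨?_, fun h => absurd h (Nat.not_lt_zero m)⟩
  rw [coeff_one]
  split_ifs with h
  · subst h
    rw [pow_zero]
    exact Submodule.one_le.1 le_rfl
  · exact zero_mem _

theorem pow_mem_reesFilt {k : ℕ} {f : E[X]} (hf : f ∈ reesFilt g k) (n : ℕ) :
    f ^ n ∈ reesFilt g (n * k) := by
  induction n with
  | zero => simpa using one_mem_reesFilt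
  | succ n ih =>
    rw [pow_succ, add_mul, one_mul]
    exact mul_mem_reesFilt ih hf

theorem eq_zero_of_mem_reesFilt (hc : g ^ c = ⊥) {k : ℕ} (hk : c ≤ k) {f : E[X]}
    (hf : f ∈ reesFilt g k) : f = 0 := by
  ext m
  rw [coeff_zero]
  rcases lt_or_ge m k with h | h
  · exact (hf m).2 h
  · have hm : g ^ m = ⊥ := by
      rw [← Nat.sub_add_cancel (hk.trans h), pow_add, hc, Submodule.mul_bot]
    simpa [hm] using (hf m).1

theorem pow_eq_zero_of_mem_reesFilt (hc : g ^ c = ⊥) {f : E[X]} (hf : f ∈ reesFilt g 1) :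
    f ^ c = 0 :=
  eq_zero_of_mem_reesFilt hc (by simp) (pow_mem_reesFilt hf c)

/-- The polynomials without constant term whose `m`-th coefficient lies in `g ∩ g ^ m`. -/
noncomputable def reesLie (g : Submodule K E) : Submodule K E[X] :=
  reesFilt g 1 ⊓
    { carrier := {f | ∀ m, f.coeff m ∈ g}
      add_mem' := fun hf hh m => by rw [coeff_add]; exact add_mem (hf m) (hh m)
      zero_mem' := fun m => by rw [coeff_zero]; exact zero_mem _
      smul_mem' := fun r f hf m => by rw [coeff_smul]; exact Submodule.smul_mem _ _ (hf m) }

theorem reesLie_bracket (hg : ∀ x ∈ g, ∀ y ∈ g, x * y - y * x ∈ g) :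
    ∀ f ∈ reesLie g, ∀ h ∈ reesLie g, f * h - h * f ∈ reesLie g := by
  intro f hf h hh
  refine ⟨reesFilt_mono (by norm_num) (sub_mem (mul_mem_reesFilt hf.1 hh.1)
    (mul_mem_reesFilt hh.1 hf.1)), fun m => ?_⟩
  rw [coeff_sub, coeff_mul, coeff_mul, ← Finset.Nat.sum_antidiagonal_swap (n := m)
    (f := fun ij => h.coeff ij.1 * f.coeff ij.2), ← sum_sub_distrib]
  exact sum_mem fun ij _ => hg _ (hf.2 _) _ (hh.2 _)

/-- The Euler derivation `X d/dX`. -/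
noncomputable def euler (K E : Type*) [Field K] [Ring E] [Algebra K E] : E[X] →ₗ[K] E[X] where
  toFun f := X * derivative f
  map_add' f h := by rw [map_add, mul_add]
  map_smul' r f := by rw [derivative_smul, mul_smul_comm, RingHom.id_apply]

theorem euler_mul (f h : E[X]) : euler K E (f * h) = euler K E f * h + f * euler K E h := by
  change X * derivative (f * h) = X * derivative f * h + f * (X * derivative h)
  rw [derivative_mul, mul_add, ← mul_assoc, ← mul_assoc, ← mul_assoc, X_mul (p := f)]

theorem euler_one : euler K E 1 = 0 := by
  change X * derivative (1 : E[X]) = 0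
  rw [derivative_one, mul_zero]

theorem coeff_euler (f : E[X]) (m : ℕ) : (euler K E f).coeff m = (m : K) • f.coeff m := by
  change (X * derivative f).coeff m = _
  rcases m with _ | m
  · simp
  · rw [coeff_X_mul, coeff_derivative, Nat.cast_smul_eq_nsmul, nsmul_eq_mul,
      ← Nat.cast_succ]
    exact (Nat.cast_commute _ _).eq.symm

theorem euler_mem_reesFilt {k : ℕ} {f : E[X]} (hf : f ∈ reesFilt g k) :
    euler K E f ∈ reesFilt g k := by
  intro m
  rw [coeff_euler]
  exact ⟨Submodule.smul_mem _ _ (hf m).1, fun hm => by rw [(hf m).2 hm, smul_zero]⟩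

theorem euler_mem_reesLie {f : E[X]} (hf : f ∈ reesLie g) : euler K E f ∈ reesLie g :=
  ⟨euler_mem_reesFilt hf.1, fun m => by
    rw [coeff_euler]; exact Submodule.smul_mem _ _ (hf.2 m)⟩

/-- `u`, with inverse `v`, normalizes `reesLie g` and has its logarithmic derivative there. -/
structure LieUnit (g : Submodule K E) (u v : E[X]) : Prop where
  mul_inv : u * v = 1
  inv_mul : v * u = 1
  mem : u ∈ reesFilt g 0
  inv_mem : v ∈ reesFilt g 0
  conj : ∀ y ∈ reesLie g, v * (y * u) ∈ reesLie g
  logDeriv : v * euler K E u ∈ reesLie g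

theorem LieUnit.mul {u v u' v' : E[X]} (h : LieUnit g u v) (h' : LieUnit g u' v') :
    LieUnit g (u * u') (v' * v) where
  mul_inv := by
    rw [mul_assoc, ← mul_assoc u', h'.mul_inv, one_mul, h.mul_inv]
  inv_mul := by
    rw [mul_assoc, ← mul_assoc v, h.inv_mul, one_mul, h'.inv_mul]
  mem := mul_mem_reesFilt h.mem h'.mem
  inv_mem := mul_mem_reesFilt h'.inv_mem h.inv_mem
  conj y hy := by
    have := h'.conj _ (h.conj y hy)
    simpa only [mul_assoc] using this
  logDeriv := by
    have h1 := h'.conj _ h.logDeriv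
    have h2 : v' * v * euler K E (u * u') =
        v' * ((v * euler K E u) * u') + v' * euler K E u' := by
      rw [euler_mul, mul_add]
      congr 1
      · simp only [mul_assoc]
      · rw [mul_assoc, ← mul_assoc v, h.inv_mul, one_mul]
    rw [h2]
    exact add_mem h1 h'.logDeriv

theorem truncExp_mem_reesFilt {f : E[X]} (hf : f ∈ reesFilt g 1) :
    truncExp K c f ∈ reesFilt g 0 :=
  sum_mem fun _ _ => Submodule.smul_mem _ _
    (reesFilt_mono (Nat.zero_le _) (pow_mem_reesFilt hf _))

theorem lieUnit_truncExp (hg : ∀ x ∈ g, ∀ y ∈ g, x * y - y * x ∈ g) (hc : g ^ c = ⊥) (hc0 : 0 < c)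
    (hK : ∀ m : ℕ, 0 < m → m < c → (m : K) ≠ 0) {f : E[X]} (hf : f ∈ reesLie g) :
    LieUnit g (truncExp K c f) (truncExp K c (-f)) where
  mul_inv := truncExp_mul_neg_self hK hc0 (pow_eq_zero_of_mem_reesFilt hc hf.1)
  inv_mul := truncExp_neg_mul_self hK hc0 (pow_eq_zero_of_mem_reesFilt hc hf.1)
  mem := truncExp_mem_reesFilt hf.1
  inv_mem := truncExp_mem_reesFilt (neg_mem hf.1)
  conj y hy := truncExp_neg_mul_mem hK (reesLie_bracket hg) (w := 0) hf
    (pow_eq_zero_of_mem_reesFilt hc hf.1) (zero_mem _) (LinearMap.mulLeft K y)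
    (fun x => by simp [mul_assoc]) (by simpa using hy) (fun i j hij => by
      refine eq_zero_of_mem_reesFilt hc (k := i * 1 + (1 + j * 1)) (by omega) ?_
      exact mul_mem_reesFilt (pow_mem_reesFilt hf.1 i)
        (mul_mem_reesFilt hy.1 (pow_mem_reesFilt hf.1 j)))
  logDeriv := truncExp_neg_mul_mem hK (reesLie_bracket hg) hf
    (pow_eq_zero_of_mem_reesFilt hc hf.1) (euler_mem_reesLie hf) (euler K E)
    (fun x => euler_mul x f) (by rw [euler_one]; exact zero_mem _) (fun i j hij => by
      refine eq_zero_of_mem_reesFilt hc (k := i * 1 + j * 1) (by omega) ?_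
      exact mul_mem_reesFilt (pow_mem_reesFilt hf.1 i)
        (euler_mem_reesFilt (pow_mem_reesFilt hf.1 j)))

theorem truncExp_sub_one_mem {f : E[X]} (hf : f ∈ reesFilt g 1) (hc0 : 0 < c) :
    truncExp K c f - 1 ∈ reesFilt g 1 := by
  obtain ⟨c, rfl⟩ := Nat.exists_eq_succ_of_ne_zero hc0.ne'
  rw [truncExp, sum_range_succ']
  simp only [Nat.factorial_zero, Nat.cast_one, inv_one, pow_zero, one_smul, add_sub_cancel_right]
  exact sum_mem fun j _ => Submodule.smul_mem _ _
    (reesFilt_mono (by omega) (pow_mem_reesFilt hf _))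

theorem add_pow_sub_pow_mem {m : ℕ} (hm : 1 ≤ m) {f x : E[X]} (hf : f ∈ reesFilt g 1)
    (hx : x ∈ reesFilt g m) (j : ℕ) :
    (f + x) ^ (j + 1) - f ^ (j + 1) ∈ reesFilt g (m + j) := by
  induction j with
  | zero => simpa using hx
  | succ j ih =>
    have h : (f + x) ^ (j + 1 + 1) - f ^ (j + 1 + 1) =
        (f + x) * ((f + x) ^ (j + 1) - f ^ (j + 1)) + x * f ^ (j + 1) := by
      rw [pow_succ' _ (j + 1), pow_succ' _ (j + 1)]
      noncomm_ring
    rw [h]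
    refine add_mem ?_ ?_
    · have := mul_mem_reesFilt (add_mem hf (reesFilt_mono hm hx)) ih
      rwa [show 1 + (m + j) = m + (j + 1) by omega] at this
    · have := mul_mem_reesFilt hx (pow_mem_reesFilt hf (j + 1))
      rwa [mul_one] at this

theorem truncExp_add_sub_mem (hc : 2 ≤ c) {m : ℕ} (hm : 1 ≤ m) {f x : E[X]}
    (hf : f ∈ reesFilt g 1) (hx : x ∈ reesFilt g m) :
    truncExp K c (f + x) - truncExp K c f - x ∈ reesFilt g (m + 1) := by
  obtain ⟨c, rfl⟩ := Nat.exists_eq_add_of_le' hc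
  have h : truncExp K (c + 2) (f + x) - truncExp K (c + 2) f - x =
      ∑ j ∈ range c, (((j + 1 + 1).factorial : ℕ) : K)⁻¹ •
        ((f + x) ^ (j + 1 + 1) - f ^ (j + 1 + 1)) := by
    simp only [truncExp, sum_range_succ', smul_sub, sum_sub_distrib]
    simp
    abel
  rw [h]
  exact sum_mem fun j _ => Submodule.smul_mem _ _
    (reesFilt_mono (by omega) (add_pow_sub_pow_mem hm hf hx (j + 1)))

theorem exists_lie_mul_truncExp_sub_one_mem (hg : ∀ x ∈ g, ∀ y ∈ g, x * y - y * x ∈ g)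
    (hc : g ^ c = ⊥) (hc2 : 2 ≤ c) (hK : ∀ m : ℕ, 0 < m → m < c → (m : K) ≠ 0) {u v : E[X]}
    (hu : LieUnit g u v) (hu1 : u - 1 ∈ reesFilt g 1) (m : ℕ) (hm : m < c) :
    ∃ z ∈ reesLie g, u * truncExp K c (-z) - 1 ∈ reesFilt g (m + 1) := by
  induction m with
  | zero =>
    refine ⟨0, zero_mem _, ?_⟩
    have : truncExp K c (0 : E[X]) = 1 := by
      rw [truncExp, sum_eq_single_of_mem 0 (mem_range.2 (by omega))]
      · simp
      · intro j _ hj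
        simp [hj]
    simpa [this] using hu1
  | succ m ih =>
    obtain ⟨z, hz, hr⟩ := ih (by omega)
    set r := u * truncExp K c (-z) - 1 with hrdef
    have hw := hu.mul (lieUnit_truncExp hg hc (by omega) hK (neg_mem hz))
    have hur : u * truncExp K c (-z) = 1 + r := by rw [hrdef]; abel
    rw [hur] at hw
    set w := truncExp K c (- -z) * v
    have hlog : w * euler K E (1 + r) = euler K E r - w * (r * euler K E r) := by
      have h1 : w = 1 - w * r := by
        have := hw.inv_mul
        rw [mul_add, mul_one] at this
        exact eq_sub_of_add_eq this
      conv_lhs => rw [h1]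
      rw [map_add, euler_one, zero_add, sub_mul, one_mul, mul_assoc]
    have hsmall : w * (r * euler K E r) ∈ reesFilt g (m + 1 + 1) := by
      refine reesFilt_mono ?_ (mul_mem_reesFilt hw.inv_mem
        (mul_mem_reesFilt hr (euler_mem_reesFilt hr)))
      omega
    have hcoeff : ((m + 1 : ℕ) : K) • r.coeff (m + 1) ∈ g := by
      have h1 := hw.logDeriv.2 (m + 1)
      rwa [hlog, coeff_sub, (hsmall (m + 1)).2 (by omega), sub_zero, coeff_euler] at h1
    have hrg : r.coeff (m + 1) ∈ g :=
      (Submodule.smul_mem_iff _ (hK _ (by omega) hm)).1 hcoeff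
    set x : E[X] := monomial (m + 1) (r.coeff (m + 1)) with hx
    have hxF : x ∈ reesFilt g (m + 1) := by
      intro k
      rw [hx, coeff_monomial]
      split_ifs with h
      · subst h
        exact ⟨(hr _).1, fun h => absurd h (lt_irrefl _)⟩
      · exact ⟨zero_mem _, fun _ => rfl⟩
    have hxL : x ∈ reesLie g := by
      refine ⟨reesFilt_mono (by omega) hxF, fun k => ?_⟩
      rw [hx, coeff_monomial]
      split_ifs
      · exact hrg
      · exact zero_mem _
    refine ⟨z + x, add_mem hz hxL, ?_⟩
    have h1 := truncExp_add_sub_mem (K := K) hc2 (by omega) (neg_mem hz.1) (neg_mem hxF)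
    have h2 : u * truncExp K c (-(z + x)) - 1 = (r - x) - (u - 1) * x +
        u * (truncExp K c (-z + -x) - truncExp K c (-z) - -x) := by
      rw [hrdef, neg_add]
      noncomm_ring
    rw [h2]
    refine add_mem (sub_mem ?_ ?_) ?_
    · intro k
      refine ⟨(sub_mem hr (reesFilt_mono le_rfl hxF) k).1, fun hk => ?_⟩
      rw [coeff_sub, hx, coeff_monomial]
      split_ifs with h
      · rw [h, sub_self]
      · rw [(hr k).2 (by omega), sub_zero]
    · exact reesFilt_mono (by omega) (mul_mem_reesFilt hu1 hxF)
    · exact reesFilt_mono (by omega) (mul_mem_reesFilt hu.mem h1)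

theorem exists_lie_eq_truncExp (hg : ∀ x ∈ g, ∀ y ∈ g, x * y - y * x ∈ g)
    (hc : g ^ c = ⊥) (hc2 : 2 ≤ c) (hK : ∀ m : ℕ, 0 < m → m < c → (m : K) ≠ 0) {u v : E[X]}
    (hu : LieUnit g u v) (hu1 : u - 1 ∈ reesFilt g 1) :
    ∃ z ∈ reesLie g, u = truncExp K c z := by
  obtain ⟨z, hz, h⟩ :=
    exists_lie_mul_truncExp_sub_one_mem hg hc hc2 hK hu hu1 (c - 1) (by omega)
  refine ⟨z, hz, ?_⟩
  have h0 := sub_eq_zero.1 (eq_zero_of_mem_reesFilt hc (by omega) h)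
  have h1 := truncExp_neg_mul_self hK (by omega) (pow_eq_zero_of_mem_reesFilt hc hz.1)
  rw [← mul_one u, ← h1, ← mul_assoc, h0, one_mul]

/-- Evaluation of a polynomial over a noncommutative ring at the central element `1`. -/
noncomputable def evalOne (E : Type*) [Ring E] : E[X] →+* E :=
  eval₂RingHom' (RingHom.id E) 1 fun a => Commute.one_right a

theorem evalOne_apply (f : E[X]) : evalOne E f = f.eval 1 := rfl

theorem evalOne_truncExp (f : E[X]) :
    evalOne E (truncExp K c f) = truncExp K c (evalOne E f) := by
  rw [truncExp, truncExp, map_sum]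
  refine sum_congr rfl fun j _ => ?_
  rw [← map_pow, evalOne_apply, evalOne_apply, eval_smul]

/-- The Baker-Campbell-Hausdorff theorem for a Lie algebra `g` of operators all of whose `c`-fold
products vanish, where `(c - 1)!` is invertible. -/
theorem exists_mem_truncExp_mul_truncExp (hg : ∀ x ∈ g, ∀ y ∈ g, x * y - y * x ∈ g)
    (hc : g ^ c = ⊥) (hc2 : 2 ≤ c) (hK : ∀ m : ℕ, 0 < m → m < c → (m : K) ≠ 0) {a b : E}
    (ha : a ∈ g) (hb : b ∈ g) :
    ∃ z ∈ g, truncExp K c a * truncExp K c b = truncExp K c z := by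
  have hmono : ∀ x ∈ g, (monomial 1 x : E[X]) ∈ reesLie g := by
    intro x hx
    refine ⟨fun m => ?_, fun m => ?_⟩ <;> rw [coeff_monomial] <;> split_ifs with h
    · subst h
      exact ⟨by rwa [pow_one], fun h => absurd h (lt_irrefl _)⟩
    · exact ⟨zero_mem _, fun _ => rfl⟩
    · exact hx
    · exact zero_mem _
  have hc0 : 0 < c := by omega
  have hua := lieUnit_truncExp hg hc hc0 hK (hmono a ha)
  have hub := lieUnit_truncExp hg hc hc0 hK (hmono b hb)
  obtain ⟨z, hz, h⟩ := exists_lie_eq_truncExp hg hc hc2 hK (hua.mul hub) (by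
    rw [show ∀ s t : E[X], s * t - 1 = (s - 1) + s * (t - 1) by intros; noncomm_ring]
    exact add_mem (truncExp_sub_one_mem (hmono a ha).1 hc0)
      (mul_mem_reesFilt hua.mem (truncExp_sub_one_mem (hmono b hb).1 hc0)))
  refine ⟨evalOne E z, ?_, ?_⟩
  · rw [evalOne_apply, eval_eq_sum_range]
    exact sum_mem fun i _ => by rw [one_pow, mul_one]; exact hz.2 i
  · have := congrArg (evalOne E) h
    rw [map_mul, evalOne_truncExp, evalOne_truncExp, evalOne_truncExp] at this
    simpa [evalOne_apply] using this

end Rees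

section Orbit

variable {K E M : Type*} [Field K] [Ring E] [Algebra K E] {g : Submodule K E} {c : ℕ}

theorem mul_pow_sub_pow_mul_eq_zero {a b : E} (ha : a ∈ g) (hb : b ∈ g) {k : ℕ}
    (hk : ∀ i j, k + 1 ≤ i + j → ∀ x ∈ g ^ i, ∀ y ∈ g ^ j, x * (a - b) * y = 0) (n : ℕ) :
    ∀ i j, k + 2 ≤ i + j + n → ∀ x ∈ g ^ i, ∀ y ∈ g ^ j, x * (a ^ n - b ^ n) * y = 0 := by
  induction n with
  | zero => intros; simp
  | succ n ih =>
    intro i j hij x hx y hy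
    have h : x * (a ^ (n + 1) - b ^ (n + 1)) * y =
        x * a * (a ^ n - b ^ n) * y + x * (a - b) * (b ^ n * y) := by
      rw [pow_succ', pow_succ']
      noncomm_ring
    rw [h, ih (i + 1) j (by omega) _ (by rw [pow_succ]; exact Submodule.mul_mem_mul hx ha) _ hy,
      hk i (n + j) (by omega) _ hx _ (by
        rw [pow_add]
        exact Submodule.mul_mem_mul (Submodule.pow_mem_pow _ hb n) hy), add_zero]

theorem truncExp_injOn (hc : g ^ c = ⊥) (hc2 : 2 ≤ c) {a b : E} (ha : a ∈ g) (hb : b ∈ g)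
    (h : truncExp K c a = truncExp K c b) : a = b := by
  have key : ∀ m k, m + k = c → ∀ i j, k ≤ i + j →
      ∀ x ∈ g ^ i, ∀ y ∈ g ^ j, x * (a - b) * y = 0 := by
    intro m
    induction m with
    | zero =>
      intro k hk i j hij x hx y hy
      have h1 : x * (a - b) * y ∈ g ^ (i + 1 + j) := by
        rw [pow_add, pow_succ]
        exact Submodule.mul_mem_mul (Submodule.mul_mem_mul hx (sub_mem ha hb)) hy
      have h2 : g ^ (i + 1 + j) = ⊥ := by
        rw [← Nat.sub_add_cancel (show c ≤ i + 1 + j by omega), pow_add, hc, Submodule.mul_bot]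
      rwa [h2, Submodule.mem_bot] at h1
    | succ m ih =>
      intro k hk i j hij x hx y hy
      have hpow := mul_pow_sub_pow_mul_eq_zero ha hb (ih (k + 1) (by omega))
      have h1 : x * (truncExp K c a - truncExp K c b) * y = x * (a - b) * y := by
        obtain ⟨d, rfl⟩ := Nat.exists_eq_add_of_le' hc2
        have h2 : truncExp K (d + 2) a - truncExp K (d + 2) b = ∑ n ∈ range d,
            (((n + 1 + 1).factorial : ℕ) : K)⁻¹ • (a ^ (n + 1 + 1) - b ^ (n + 1 + 1)) +
            (a - b) := by
          simp only [truncExp, sum_range_succ', smul_sub, sum_sub_distrib]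
          simp
          abel
        rw [h2, mul_add, add_mul, mul_sum, sum_mul, sum_eq_zero, zero_add]
        intro n _
        rw [mul_smul_comm, smul_mul_assoc, hpow _ i j (by omega) x hx y hy, smul_zero]
      rw [← h1, h, sub_self, mul_zero, zero_mul]
  have h1 : (1 : E) ∈ g ^ 0 := by
    rw [pow_zero]
    exact Submodule.one_le.1 le_rfl
  have := key c 0 (by omega) 0 0 le_rfl 1 h1 1 h1
  rwa [one_mul, mul_one, sub_eq_zero] at this

theorem smul_eq_zero_of_truncExp_smul [AddCommGroup M] [Module K M] [Module E M]
    [IsScalarTower K E M] {z : E} (hz : z ^ c = 0) (hc2 : 2 ≤ c) {v : M}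
    (h : truncExp K c z • v = v) : z • v = 0 := by
  have key : ∀ m k, m + k = c → z ^ (k + 1) • v = 0 := by
    intro m
    induction m with
    | zero =>
      intro k hk
      rw [pow_eq_zero_of_le (by omega) hz, zero_smul]
    | succ m ih =>
      intro k hk
      have hzero : ∀ n, k + 2 ≤ n → z ^ n • v = 0 := by
        intro n hn
        rw [← Nat.sub_add_cancel hn, pow_add, mul_smul, ih (k + 1) (by omega), smul_zero]
      have h1 : z ^ k • (truncExp K c z • v) = z ^ k • v + z ^ (k + 1) • v := by
        obtain ⟨d, rfl⟩ := Nat.exists_eq_add_of_le' hc2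
        rw [truncExp, sum_range_succ', sum_range_succ', smul_smul, mul_add, mul_add, mul_sum,
          add_smul, add_smul, sum_smul, sum_eq_zero]
        · simp [pow_succ, add_comm]
        · intro n _
          rw [mul_smul_comm, ← pow_add, smul_assoc, hzero _ (by omega), smul_zero]
      rw [h] at h1
      exact left_eq_add.1 h1
  simpa using key c 0 (by omega)

/-- If no nonzero element of `g` kills `v`, then the map `a ↦ exp a • v` is injective on `g`. -/
theorem eq_of_truncExp_smul_eq [AddCommGroup M] [Module K M] [Module E M]
    [IsScalarTower K E M] (hg : ∀ x ∈ g, ∀ y ∈ g, x * y - y * x ∈ g) (hc : g ^ c = ⊥)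
    (hc0 : 0 < c) (hK : ∀ m : ℕ, 0 < m → m < c → (m : K) ≠ 0) {v : M}
    (hv : ∀ x ∈ g, x • v = 0 → x = 0) {a b : E} (ha : a ∈ g) (hb : b ∈ g)
    (h : truncExp K c a • v = truncExp K c b • v) : a = b := by
  rcases Nat.lt_or_ge c 2 with hc1 | hc2
  · obtain rfl : c = 1 := by omega
    rw [pow_one] at hc
    rw [hc, Submodule.mem_bot] at ha hb
    rw [ha, hb]
  have hnil : ∀ x ∈ g, x ^ c = 0 := fun x hx => by
    have := Submodule.pow_mem_pow g hx c
    rwa [hc, Submodule.mem_bot] at this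
  obtain ⟨z, hz, hexp⟩ := exists_mem_truncExp_mul_truncExp hg hc hc2 hK (neg_mem hb) ha
  have h1 : truncExp K c z • v = v := by
    rw [← hexp, mul_smul, h, smul_smul, truncExp_neg_mul_self hK hc0 (hnil b hb), one_smul]
  have hz0 : z = 0 := hv z hz (smul_eq_zero_of_truncExp_smul (hnil z hz) hc2 h1)
  refine truncExp_injOn hc hc2 ha hb ?_
  have h0 : truncExp K c (0 : E) = 1 := by
    rw [truncExp, sum_eq_single_of_mem 0 (mem_range.2 hc0)]
    · simp
    · intro j _ hj
      simp [hj]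
  rw [hz0, h0] at hexp
  rw [← one_mul (truncExp K c a), ← truncExp_mul_neg_self hK hc0 (hnil b hb), mul_assoc, hexp,
    mul_one]

end Orbit

end TruncExp

namespace PreLieRing

variable {A : Type*} [PreLieRing A]

/-- The multiplication of a pre-Lie ring as a bi-additive map. -/
def mulHom : A →+ A →+ A :=
  AddMonoidHom.mk' (fun x => AddMonoidHom.mk' (mul x) (mul_add' x))
    fun x y => AddMonoidHom.ext fun z => add_mul' x y z

theorem mulHom_apply (x y : A) : mulHom x y = mul x y := rfl

theorem mul_nsmul' (x y : A) (k : ℕ) : mul x (k • y) = k • mul x y :=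
  map_nsmul (mulHom x) k y

theorem nsmul_mul' (x y : A) (k : ℕ) : mul (k • x) y = k • mul x y :=
  DFunLike.congr_fun (map_nsmul (mulHom (A := A)) k x) y

theorem mul_zero' (x : A) : mul x 0 = 0 := map_zero (mulHom x)

theorem sub_mul' (x y z : A) : mul (x - y) z = mul x z - mul y z :=
  DFunLike.congr_fun (map_sub (mulHom (A := A)) x y) z

/-- The additive subgroup generated by the nested products of `m` elements. -/
def nestedPow (A : Type*) [PreLieRing A] (m : ℕ) : AddSubgroup A :=
  AddSubgroup.closure {x | ∃ (l : List A) (b : A), l.length + 1 = m ∧ nestedMul l b = x}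

theorem nestedMul_mem_nestedPow (l : List A) (b : A) :
    nestedMul l b ∈ nestedPow A (l.length + 1) :=
  AddSubgroup.subset_closure ⟨l, b, rfl, rfl⟩

theorem nestedPow_le {m : ℕ} {H : AddSubgroup A}
    (h : ∀ (l : List A) (b : A), l.length + 1 = m → nestedMul l b ∈ H) : nestedPow A m ≤ H := by
  rw [nestedPow, AddSubgroup.closure_le]
  rintro _ ⟨l, b, hl, rfl⟩
  exact h l b hl

theorem mem_nestedPow_one (x : A) : x ∈ nestedPow A 1 := nestedMul_mem_nestedPow [] x

theorem mul_mem_nestedPow (x : A) {z : A} {m : ℕ} (hz : z ∈ nestedPow A m) :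
    mul x z ∈ nestedPow A (m + 1) := by
  have : nestedPow A m ≤ (nestedPow A (m + 1)).comap (mulHom x) :=
    nestedPow_le fun l b hl => by
      subst hl
      exact nestedMul_mem_nestedPow (x :: l) b
  exact this hz

theorem nestedPow_succ_le {m : ℕ} (hm : 1 ≤ m) : nestedPow A (m + 1) ≤ nestedPow A m := by
  induction m, hm using Nat.le_induction with
  | base => exact fun x _ => mem_nestedPow_one x
  | succ m hm ih =>
    refine nestedPow_le fun l b hl => ?_
    match l, hl with
    | a :: l, hl =>
      refine mul_mem_nestedPow a (ih ?_)
      have := nestedMul_mem_nestedPow l b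
      rwa [show l.length + 1 = m + 1 by simpa using hl] at this

theorem nestedPow_le_of_le {k m : ℕ} (hk : 1 ≤ k) (hkm : k ≤ m) :
    nestedPow A m ≤ nestedPow A k := by
  induction m, hkm using Nat.le_induction with
  | base => exact le_rfl
  | succ m hm ih => exact (nestedPow_succ_le (hk.trans hm)).trans ih

theorem Lpow_succ (a : A) (m : ℕ) (x : A) : Lpow a (m + 1) x = mul a (Lpow a m x) :=
  Function.iterate_succ_apply' _ _ _

theorem Lpow_zero (a x : A) : Lpow a 0 x = x := rfl

theorem Lpow_mem_nestedPow (a : A) (m : ℕ) {k : ℕ} {x : A} (hx : x ∈ nestedPow A k) :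
    Lpow a m x ∈ nestedPow A (k + m) := by
  induction m with
  | zero => exact hx
  | succ m ih => rw [Lpow_succ]; exact mul_mem_nestedPow a ih

section Quotient

variable (p : ℕ) (I : AddSubgroup A) [Module (ZMod p) (A ⧸ I)]

/-- Left multiplication by `x` on the quotient by a left ideal. -/
def quotientMulLeft (hI : ∀ x : A, ∀ y ∈ I, mul x y ∈ I) (x : A) :
    A ⧸ I →ₗ[ZMod p] A ⧸ I :=
  AddMonoidHom.toZModLinearMap p (QuotientAddGroup.map I I (mulHom x) (hI x))

/-- The endomorphism `(y, t) ↦ (x·y + t•x, 0)` of `(A ⧸ I) × ZMod p`. -/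
def affineEnd (hI : ∀ x : A, ∀ y ∈ I, mul x y ∈ I) (x : A) :
    Module.End (ZMod p) ((A ⧸ I) × ZMod p) :=
  LinearMap.inl (ZMod p) (A ⧸ I) (ZMod p) ∘ₗ
    (quotientMulLeft p I hI x ∘ₗ LinearMap.fst (ZMod p) (A ⧸ I) (ZMod p) +
      LinearMap.toSpanSingleton (ZMod p) (A ⧸ I) (x : A ⧸ I) ∘ₗ
        LinearMap.snd (ZMod p) (A ⧸ I) (ZMod p))

theorem affineEnd_mk (hI : ∀ x : A, ∀ y ∈ I, mul x y ∈ I) (x y : A) (t : ZMod p) :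
    affineEnd p I hI x ((y : A ⧸ I), t) = (((mul x y : A) : A ⧸ I) + t • (x : A ⧸ I), 0) := rfl

theorem affineEnd_ext {f g : Module.End (ZMod p) ((A ⧸ I) × ZMod p)}
    (h : ∀ (y : A) (t : ZMod p), f ((y : A ⧸ I), t) = g ((y : A ⧸ I), t)) : f = g := by
  refine LinearMap.ext ?_
  rintro ⟨y, t⟩
  induction y using QuotientAddGroup.induction_on with
  | H y => exact h y t

theorem affineEnd_add (hI : ∀ x : A, ∀ y ∈ I, mul x y ∈ I) (x x' : A) :
    affineEnd p I hI (x + x') = affineEnd p I hI x + affineEnd p I hI x' := by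
  refine affineEnd_ext p I fun y t => ?_
  rw [LinearMap.add_apply, affineEnd_mk, affineEnd_mk, affineEnd_mk, add_mul']
  simp only [QuotientAddGroup.mk_add, smul_add, Prod.mk_add_mk, add_zero]
  congr 1
  abel

/-- `affineEnd` as an additive map. -/
def affineEndHom (hI : ∀ x : A, ∀ y ∈ I, mul x y ∈ I) :
    A →+ Module.End (ZMod p) ((A ⧸ I) × ZMod p) :=
  AddMonoidHom.mk' (affineEnd p I hI) (affineEnd_add p I hI)

theorem affineEnd_commutator (hI : ∀ x : A, ∀ y ∈ I, mul x y ∈ I) (x y : A) :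
    affineEnd p I hI x * affineEnd p I hI y - affineEnd p I hI y * affineEnd p I hI x =
      affineEnd p I hI (mul x y - mul y x) := by
  refine affineEnd_ext p I fun z t => ?_
  rw [LinearMap.sub_apply, Module.End.mul_apply, Module.End.mul_apply, affineEnd_mk,
    affineEnd_mk, affineEnd_mk]
  obtain ⟨k, rfl⟩ : ∃ k : ℤ, (k : ZMod p) = t := ZMod.intCast_surjective t
  simp only [Int.cast_smul_eq_zsmul, ← QuotientAddGroup.mk_zsmul, ← QuotientAddGroup.mk_add]
  rw [affineEnd_mk, affineEnd_mk, Prod.mk_sub_mk]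
  simp only [zero_smul, add_zero, sub_zero, ← QuotientAddGroup.mk_sub]
  congr 2
  have h := pre_lie x y z
  rw [mul_add', mul_add', sub_mul', ← mulHom_apply x (k • y), ← mulHom_apply y (k • x),
    map_zsmul, map_zsmul, mulHom_apply, mulHom_apply, smul_sub]
  rw [sub_eq_sub_iff_add_eq_add] at h
  have h2 : mul x (mul y z) - mul y (mul x z) = mul (mul x y) z - mul (mul y x) z := by
    rw [sub_eq_sub_iff_add_eq_add]
    rw [add_comm, ← h, add_comm]
  rw [← h2]
  abel

end Quotient

open Finset in
/-- In a pre-Lie ring of exponent `p` modulo an ideal, nilpotent for nested products of length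
`c ≤ p`, the truncated exponential `∑ (j!)⁻¹ L_a^{j-1}(a)` is injective. -/
theorem sub_mem_of_sum_Lpow_sub_mem {p c : ℕ} [Fact p.Prime] (I : AddSubgroup A)
    (hIl : ∀ x : A, ∀ y ∈ I, mul x y ∈ I) (hIr : ∀ x ∈ I, ∀ y : A, mul x y ∈ I)
    (hpI : ∀ x : A, p • x ∈ I) (hcI : nestedPow A c ≤ I) (hc0 : 0 < c) (hcp : c ≤ p)
    {σ : ℕ → ℤ} (hσ : ∀ j, 1 ≤ j → j < c → (p : ℤ) ∣ σ j * (j.factorial : ℤ) - 1) {a b : A}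
    (h : ∑ j ∈ range (c - 1), σ (j + 1) • (Lpow a j a - Lpow b j b) ∈ I) : a - b ∈ I := by
  let _ : Module (ZMod p) (A ⧸ I) := AddCommGroup.zmodModule fun x => by
    induction x using QuotientAddGroup.induction_on with
    | H x => exact (QuotientAddGroup.eq_zero_iff _).2 (hpI x)
  let g : Submodule (ZMod p) (Module.End (ZMod p) ((A ⧸ I) × ZMod p)) :=
    AddSubgroup.toZModSubmodule p (affineEndHom p I hIl).range
  have hmem (x : A) : affineEnd p I hIl x ∈ g := ⟨x, rfl⟩
  let v : (A ⧸ I) × ZMod p := ((0 : A), 1)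
  have hv (x : A) : affineEnd p I hIl x v = ((x : A ⧸ I), 0) := by
    rw [affineEnd_mk, mul_zero', QuotientAddGroup.mk_zero, one_smul, zero_add]
  have hg : ∀ x ∈ g, ∀ y ∈ g, x * y - y * x ∈ g := by
    rintro _ ⟨x, rfl⟩ _ ⟨y, rfl⟩
    exact ⟨_, (affineEnd_commutator p I hIl x y).symm⟩
  have hpow : ∀ m, ∀ f ∈ g ^ (m + 1), ∀ w, ∃ z ∈ nestedPow A (m + 1),
      f w = (((z : A) : A ⧸ I), 0) := by
    intro m
    induction m with
    | zero =>
      rintro f hf ⟨y, t⟩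
      rw [zero_add, pow_one] at hf
      obtain ⟨x, rfl⟩ := hf
      induction y using QuotientAddGroup.induction_on with
      | H y =>
        obtain ⟨k, rfl⟩ : ∃ k : ℤ, (k : ZMod p) = t := ZMod.intCast_surjective t
        refine ⟨mul x y + k • x, mem_nestedPow_one _, ?_⟩
        refine (affineEnd_mk p I hIl x y k).trans ?_
        rw [Int.cast_smul_eq_zsmul]
        rfl
    | succ m ih =>
      intro f hf w
      rw [pow_succ'] at hf
      induction hf using Submodule.mul_induction_on' with
      | mem_mul_mem f hf f' hf' =>
        obtain ⟨x, rfl⟩ := hf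
        obtain ⟨z, hz, hz'⟩ := ih f' hf' w
        refine ⟨mul x z, mul_mem_nestedPow x hz, ?_⟩
        rw [Module.End.mul_apply, hz']
        refine (affineEnd_mk p I hIl x z 0).trans ?_
        rw [zero_smul, add_zero]
      | add f _ f' _ hf hf' =>
        obtain ⟨z, hz, hz'⟩ := hf
        obtain ⟨y, hy, hy'⟩ := hf'
        refine ⟨z + y, add_mem hz hy, ?_⟩
        rw [LinearMap.add_apply, hz', hy', Prod.mk_add_mk, add_zero]
        rfl
  have hgc : g ^ c = ⊥ := by
    obtain ⟨c, rfl⟩ := Nat.exists_eq_add_of_lt hc0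
    rw [zero_add] at hcI ⊢
    refine eq_bot_iff.2 fun f hf => LinearMap.ext fun w => ?_
    obtain ⟨z, hz, hz'⟩ := hpow c f hf w
    rw [hz', (QuotientAddGroup.eq_zero_iff z).2 (hcI hz)]
    rfl
  have hK : ∀ m : ℕ, 0 < m → m < c → (m : ZMod p) ≠ 0 := fun m hm hmc h0 =>
    absurd (Nat.le_of_dvd hm ((ZMod.natCast_eq_zero_iff m p).1 h0)) (by omega)
  have hvinj : ∀ x ∈ g, x • v = 0 → x = 0 := by
    rintro _ ⟨x, rfl⟩ hx
    have hx : affineEnd p I hIl x v = 0 := hx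
    rw [hv] at hx
    have hxI := (QuotientAddGroup.eq_zero_iff x).1 (congrArg Prod.fst hx)
    refine affineEnd_ext p I fun y t => ?_
    refine (affineEnd_mk p I hIl x y t).trans ?_
    rw [(QuotientAddGroup.eq_zero_iff x).2 hxI, (QuotientAddGroup.eq_zero_iff _).2 (hIr x hxI y)]
    simp
  have hexp (x : A) : truncExp (ZMod p) c (affineEnd p I hIl x) • v =
      v + ((↑(∑ j ∈ range (c - 1), σ (j + 1) • Lpow x j x) : A ⧸ I), 0) := by
    have hpw (j : ℕ) : (affineEnd p I hIl x ^ (j + 1)) v = (((Lpow x j x : A) : A ⧸ I), 0) := by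
      induction j with
      | zero => rw [zero_add, pow_one, hv]; rfl
      | succ j ih =>
        rw [pow_succ', Module.End.mul_apply, ih, affineEnd_mk, zero_smul, add_zero, Lpow_succ]
    obtain ⟨d, rfl⟩ := Nat.exists_eq_add_of_lt hc0
    rw [zero_add, Nat.add_sub_cancel, truncExp, sum_range_succ', add_smul, sum_smul]
    have hfst : ∑ j ∈ range d, σ (j + 1) • (((Lpow x j x : A) : A ⧸ I), (0 : ZMod p)) =
        ((↑(∑ j ∈ range d, σ (j + 1) • Lpow x j x) : A ⧸ I), 0) := by
      ext
      · rw [Prod.fst_sum, QuotientAddGroup.mk_sum]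
        rfl
      · rw [Prod.snd_sum]
        exact sum_eq_zero fun j _ => by simp
    rw [← hfst, add_comm]
    congr 1
    · simp
    · refine sum_congr rfl fun j hj => ?_
      rw [smul_assoc]
      have hj1 := hσ (j + 1) (by omega) (by have := mem_range.1 hj; omega)
      have : (((j + 1).factorial : ℕ) : ZMod p)⁻¹ = (σ (j + 1) : ZMod p) := by
        rw [← ZMod.intCast_zmod_eq_zero_iff_dvd] at hj1
        push_cast at hj1
        exact (eq_inv_of_mul_eq_one_left (sub_eq_zero.1 hj1)).symm
      rw [this, Int.cast_smul_eq_zsmul]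
      exact congrArg _ (hpw j)
  have key := TruncExp.eq_of_truncExp_smul_eq hg hgc hc0 hK hvinj (hmem a) (hmem b) (by
    rw [hexp, hexp]
    congr 2
    rw [← sub_eq_zero, ← QuotientAddGroup.mk_sub, ← sum_sub_distrib]
    simp only [← smul_sub]
    exact (QuotientAddGroup.eq_zero_iff _).2 h)
  have := congrArg (fun f => (f v).1) key
  simp only [hv] at this
  rwa [← sub_eq_zero, ← QuotientAddGroup.mk_sub, QuotientAddGroup.eq_zero_iff] at this

end PreLieRing

namespace PreLieRing

variable {A : Type*} [PreLieRing A]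

/-- `pA p i` as an additive subgroup. -/
def pSubgroup (A : Type*) [PreLieRing A] (p i : ℕ) : AddSubgroup A :=
  (nsmulAddMonoidHom (p ^ i)).range

theorem pow_smul_mem_pSubgroup {p k : ℕ} (i : ℕ) {x : A} (hx : x ∈ pSubgroup A p k) :
    p ^ i • x ∈ pSubgroup A p (i + k) := by
  obtain ⟨y, rfl⟩ := hx
  exact ⟨y, show p ^ (i + k) • y = p ^ i • p ^ k • y by rw [pow_add, mul_smul]⟩

theorem mul_mem_pSubgroup {p i : ℕ} (x : A) {y : A} (hy : y ∈ pSubgroup A p i) :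
    mul x y ∈ pSubgroup A p i := by
  obtain ⟨y, rfl⟩ := hy
  exact ⟨mul x y, (mul_nsmul' _ _ _).symm⟩

theorem mul_mem_pSubgroup_right {p i : ℕ} {x : A} (hx : x ∈ pSubgroup A p i) (y : A) :
    mul x y ∈ pSubgroup A p i := by
  obtain ⟨x, rfl⟩ := hx
  exact ⟨mul x y, (nsmul_mul' _ _ _).symm⟩

/-- The pre-Lie ring `A[ε]` with `ε ^ 2 = q ε`; the pair `(x, y)` stands for `x + y ε`. -/
@[ext]
structure Thickening (A : Type*) (q : ℕ) where
  /-- The constant coefficient. -/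
  fst : A
  /-- The coefficient of `ε`. -/
  snd : A

namespace Thickening

variable {q : ℕ}

/-- The underlying pair. -/
def equivProd (A : Type*) (q : ℕ) : Thickening A q ≃ A × A where
  toFun w := (w.fst, w.snd)
  invFun w := ⟨w.1, w.2⟩

instance : AddCommGroup (Thickening A q) := (equivProd A q).addCommGroup

theorem fst_add (w w' : Thickening A q) : (w + w').fst = w.fst + w'.fst := rfl
theorem snd_add (w w' : Thickening A q) : (w + w').snd = w.snd + w'.snd := rfl
theorem snd_sub (w w' : Thickening A q) : (w - w').snd = w.snd - w'.snd := rfl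

instance : PreLieRing (Thickening A q) where
  mul w w' :=
    ⟨mul w.fst w'.fst, mul w.fst w'.snd + mul w.snd w'.fst + q • mul w.snd w'.snd⟩
  add_mul' w w' z := by
    ext
    · exact add_mul' _ _ _
    · simp only [fst_add, snd_add, add_mul', smul_add]
      abel
  mul_add' w w' z := by
    ext
    · exact mul_add' _ _ _
    · simp only [fst_add, snd_add, mul_add', smul_add]
      abel
  pre_lie x y z := by
    ext
    · exact pre_lie _ _ _
    · simp only [snd_sub, add_mul', mul_add', mul_nsmul', nsmul_mul']
      linear_combination (norm := module) pre_lie x.fst y.fst z.snd + pre_lie x.fst y.snd z.fst +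
        pre_lie x.snd y.fst z.fst + q • pre_lie x.fst y.snd z.snd +
        q • pre_lie x.snd y.fst z.snd + q • pre_lie x.snd y.snd z.fst +
        (q * q) • pre_lie x.snd y.snd z.snd

theorem fst_mul (w w' : Thickening A q) : (mul w w').fst = mul w.fst w'.fst := rfl

theorem snd_mul (w w' : Thickening A q) :
    (mul w w').snd = mul w.fst w'.snd + mul w.snd w'.fst + q • mul w.snd w'.snd := rfl

/-- The constant coefficient as an additive map. -/
def fstHom (A : Type*) [PreLieRing A] (q : ℕ) : Thickening A q →+ A :=
  AddMonoidHom.mk' fst fst_add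

/-- The coefficient of `ε` as an additive map. -/
def sndHom (A : Type*) [PreLieRing A] (q : ℕ) : Thickening A q →+ A :=
  AddMonoidHom.mk' snd snd_add

/-- Evaluation at `ε = q` as an additive map. -/
def evalHom (A : Type*) [PreLieRing A] (q : ℕ) : Thickening A q →+ A :=
  fstHom A q + q • sndHom A q

theorem evalHom_apply (w : Thickening A q) : evalHom A q w = w.fst + q • w.snd := rfl

theorem evalHom_mul (w w' : Thickening A q) :
    evalHom A q (mul w w') = mul (evalHom A q w) (evalHom A q w') := by
  simp only [evalHom_apply, fst_mul, snd_mul, add_mul', mul_add', mul_nsmul', nsmul_mul']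
  module

theorem nestedPow_le (m : ℕ) : nestedPow (Thickening A q) m ≤
    (nestedPow A m).comap (fstHom A q) ⊓ (nestedPow A m).comap (sndHom A q) := by
  refine PreLieRing.nestedPow_le ?_
  rintro l b rfl
  induction l with
  | nil => exact ⟨mem_nestedPow_one _, mem_nestedPow_one _⟩
  | cons a l ih =>
    exact ⟨mul_mem_nestedPow _ ih.1, add_mem (add_mem (mul_mem_nestedPow _ ih.2)
      (mul_mem_nestedPow _ ih.1)) (nsmul_mem (mul_mem_nestedPow _ ih.2) _)⟩

theorem map_Lpow {B C : Type*} [PreLieRing B] [PreLieRing C] (f : B → C)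
    (hf : ∀ x y, f (mul x y) = mul (f x) (f y)) (a : B) (m : ℕ) (x : B) :
    f (Lpow a m x) = Lpow (f a) m (f x) := by
  induction m with
  | zero => rfl
  | succ m ih => rw [Lpow_succ, Lpow_succ, hf, ih]

theorem snd_Lpow_eq_zero {b : Thickening A q} (hb : b.snd = 0) (m : ℕ) :
    (Lpow b m b).snd = 0 := by
  induction m with
  | zero => exact hb
  | succ m ih =>
    have h0 (x : A) : mul 0 x = 0 := DFunLike.congr_fun (map_zero (mulHom (A := A))) x
    rw [Lpow_succ, snd_mul, ih, hb, mul_zero', h0, h0, smul_zero, add_zero, add_zero]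

/-- The ideal of pairs `(x, y)` with `x ∈ p A` and `p ^ i y ∈ p ^ (i + 1) A`. -/
def thickIdeal (A : Type*) [PreLieRing A] (q p i : ℕ) : AddSubgroup (Thickening A q) :=
  (pSubgroup A p 1).comap (fstHom A q) ⊓
    (pSubgroup A p (i + 1)).comap ((nsmulAddMonoidHom (p ^ i)).comp (sndHom A q))

theorem mem_thickIdeal {p i : ℕ} {w : Thickening A q} : w ∈ thickIdeal A q p i ↔
    w.fst ∈ pSubgroup A p 1 ∧ p ^ i • w.snd ∈ pSubgroup A p (i + 1) := Iff.rfl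

theorem mul_mem_thickIdeal {p i : ℕ} (w : Thickening A q) {w' : Thickening A q}
    (h : w' ∈ thickIdeal A q p i) : mul w w' ∈ thickIdeal A q p i := by
  refine ⟨mul_mem_pSubgroup _ h.1, ?_⟩
  change p ^ i • (mul w w').snd ∈ pSubgroup A p (i + 1)
  rw [snd_mul, smul_add, smul_add, ← mul_nsmul' w.fst w'.snd,
    smul_comm _ q, ← mul_nsmul' w.snd w'.snd]
  exact add_mem (add_mem (mul_mem_pSubgroup _ h.2)
    (pow_smul_mem_pSubgroup i (mul_mem_pSubgroup _ h.1)))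
    (nsmul_mem (mul_mem_pSubgroup _ h.2) _)

theorem mul_mem_thickIdeal_right {p i : ℕ} {w : Thickening A q}
    (h : w ∈ thickIdeal A q p i) (w' : Thickening A q) : mul w w' ∈ thickIdeal A q p i := by
  refine ⟨mul_mem_pSubgroup_right h.1 _, ?_⟩
  change p ^ i • (mul w w').snd ∈ pSubgroup A p (i + 1)
  rw [snd_mul, smul_add, smul_add, ← nsmul_mul' w.snd w'.fst, smul_comm _ q,
    ← nsmul_mul' w.snd w'.snd]
  exact add_mem (add_mem (pow_smul_mem_pSubgroup i (mul_mem_pSubgroup_right h.1 _))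
    (mul_mem_pSubgroup_right h.2 _)) (nsmul_mem (mul_mem_pSubgroup_right h.2 _) _)

end Thickening

open Finset Thickening in
/-- If `a` and `b` are congruent modulo `p ^ i` and their truncated exponentials are congruent
modulo `p ^ (i + 1)`, then `a` and `b` are congruent modulo `p ^ (i + 1)`. -/
theorem pow_smul_mem_of_sum_Lpow_sub_mem {p c : ℕ} (hp : p.Prime)
    (hcA : nestedPow A c ≤ pSubgroup A p 1) (hc0 : 0 < c) (hcp : c ≤ p)
    {σ : ℕ → ℤ} (hσ : ∀ j, 1 ≤ j → j < c → (p : ℤ) ∣ σ j * (j.factorial : ℤ) - 1)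
    {b d : A} {i : ℕ} (h : ∑ j ∈ range (c - 1), σ (j + 1) •
      (Lpow (b + p ^ i • d) j (b + p ^ i • d) - Lpow b j b) ∈ pSubgroup A p (i + 1)) :
    p ^ i • d ∈ pSubgroup A p (i + 1) := by
  have := Fact.mk hp
  let α : Thickening A (p ^ i) := ⟨b, d⟩
  let β : Thickening A (p ^ i) := ⟨b, 0⟩
  have hmem : α - β ∈ thickIdeal A (p ^ i) p i := by
    refine sub_mem_of_sum_Lpow_sub_mem (p := p) (c := c) (σ := σ) (thickIdeal A (p ^ i) p i)
      (fun x y hy => mul_mem_thickIdeal x hy) (fun x hx y => mul_mem_thickIdeal_right hx y)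
      (fun x => ?_) (fun x hx => ?_) hc0 hcp hσ ?_
    · refine ⟨⟨x.fst, ?_⟩, ⟨x.snd, ?_⟩⟩
      · rw [map_nsmul]
        exact congrArg (· • x.fst) (pow_one p)
      · rw [map_nsmul]
        exact (congrArg (· • x.snd) (pow_succ' p i)).trans (mul_smul _ _ _)
    · obtain ⟨h1, h2⟩ := Thickening.nestedPow_le c hx
      exact ⟨hcA h1, pow_smul_mem_pSubgroup i (hcA h2)⟩
    · have hfst : ∀ j, (Lpow α j α).fst = (Lpow β j β).fst := fun j => by
        rw [map_Lpow fst fst_mul, map_Lpow fst fst_mul]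
      have hsnd : ∀ j, p ^ i • (Lpow α j α - Lpow β j β).snd =
          Lpow (b + p ^ i • d) j (b + p ^ i • d) - Lpow b j b := fun j => by
        have h1 := map_Lpow (evalHom A (p ^ i)) evalHom_mul α j α
        rw [evalHom_apply, hfst, map_Lpow fst fst_mul] at h1
        rw [snd_sub, snd_Lpow_eq_zero (b := β) rfl, sub_zero]
        exact eq_sub_of_add_eq' h1
      refine ⟨?_, ?_⟩
      · refine AddSubgroup.mem_comap.2 ?_
        rw [map_sum, sum_eq_zero fun j _ => ?_]
        · exact zero_mem _
        · rw [map_zsmul]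
          exact (congrArg _ (sub_eq_zero.2 (hfst j))).trans (smul_zero _)
      · refine AddSubgroup.mem_comap.2 ?_
        rw [map_sum]
        convert h using 2 with j
        rw [map_zsmul]
        exact congrArg _ (hsnd j)
  have h2 := (mem_thickIdeal.1 hmem).2
  rwa [snd_sub, show β.snd = 0 from rfl, sub_zero] at h2

end PreLieRing

namespace PreLieRing

variable {A : Type*} [PreLieRing A]

theorem nestedMul_append (l l' : List A) (b : A) :
    nestedMul (l ++ l') b = nestedMul l (nestedMul l' b) := by
  induction l with
  | nil => rfl
  | cons a l ih => exact congrArg (mul a) ih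

theorem nestedMul_nsmul (l : List A) (k : ℕ) (b : A) :
    nestedMul l (k • b) = k • nestedMul l b := by
  induction l with
  | nil => rfl
  | cons a l ih => exact (congrArg (mul a) ih).trans (mul_nsmul' _ _ _)

theorem nestedMul_replicate (a : A) (m : ℕ) (x : A) :
    nestedMul (List.replicate m a) x = Lpow a m x := by
  induction m with
  | zero => rfl
  | succ m ih => exact (congrArg (mul a) ih).trans (Lpow_succ a m x).symm

theorem Lpow_add (a : A) (k m : ℕ) (x : A) : Lpow a (k + m) x = Lpow a k (Lpow a m x) :=
  Function.iterate_add_apply _ _ _ _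

theorem Lpow_nsmul (a : A) (m k : ℕ) (x : A) : Lpow a m (k • x) = k • Lpow a m x := by
  rw [← nestedMul_replicate, nestedMul_nsmul, nestedMul_replicate]

theorem Lpow_add_right (a : A) (m : ℕ) (x y : A) :
    Lpow a m (x + y) = Lpow a m x + Lpow a m y := by
  induction m with
  | zero => rfl
  | succ m ih => rw [Lpow_succ, Lpow_succ, Lpow_succ, ih, mul_add']

theorem Lpow_zero_right (a : A) (m : ℕ) : Lpow a m 0 = 0 := by
  simpa using Lpow_nsmul a m 0 (0 : A)

theorem nestedPow_mul_le {p c : ℕ} (hc0 : 0 < c) (hcA : nestedPow A c ≤ pSubgroup A p 1)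
    (k : ℕ) : nestedPow A (c * k) ≤ pSubgroup A p k := by
  induction k with
  | zero => exact fun x _ => ⟨x, by simp⟩
  | succ k ih =>
    refine nestedPow_le fun l b hl => ?_
    rw [mul_add, mul_one] at hl
    have hdrop : nestedMul (l.drop (c * k)) b ∈ nestedPow A c := by
      have := nestedMul_mem_nestedPow (l.drop (c * k)) b
      rwa [List.length_drop, show l.length - c * k + 1 = c by omega] at this
    obtain ⟨w, hw⟩ := hcA hdrop
    rw [← List.take_append_drop (c * k) l, nestedMul_append, ← hw, nsmulAddMonoidHom_apply,
      nestedMul_nsmul, add_comm k 1]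
    refine pow_smul_mem_pSubgroup 1 ?_
    rcases Nat.eq_zero_or_pos k with rfl | hk
    · exact ⟨nestedMul (l.take (c * 0)) w, by simp⟩
    · refine ih (nestedPow_le_of_le (Nat.mul_pos hc0 hk) (Nat.le_succ _) ?_)
      have := nestedMul_mem_nestedPow (l.take (c * k)) w
      rwa [List.length_take, min_eq_left (by omega)] at this

theorem nestedPow_le_pSubgroup {p c : ℕ} (hc0 : 0 < c) (hcA : nestedPow A c ≤ pSubgroup A p 1)
    {k m : ℕ} (h : c * k ≤ m) : nestedPow A m ≤ pSubgroup A p k := by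
  rcases Nat.eq_zero_or_pos k with rfl | hk
  · exact fun x _ => ⟨x, by simp⟩
  · exact (nestedPow_le_of_le (Nat.mul_pos hc0 hk) h).trans (nestedPow_mul_le hc0 hcA k)

theorem Lpow_eq_zero_of_mem_ann {p : ℕ} (hP3 : Property3 p A) {s m : ℕ}
    (hm : (p - 1) / 4 * s ≤ m) (a : A) {y : A} (hy : y ∈ ann p s) : Lpow a m y = 0 := by
  rcases Nat.eq_zero_or_pos s with rfl | hs
  · have hy : p ^ 0 • y = 0 := hy
    rw [pow_zero, one_smul] at hy
    rw [hy, Lpow_zero_right]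
  have key (k : ℕ) : ∃ z ∈ ann p s, Lpow a ((p - 1) / 4 * k) y = p ^ k • z := by
    induction k with
    | zero => exact ⟨y, hy, by simp [Lpow_zero]⟩
    | succ k ih =>
      obtain ⟨z, hz, hz'⟩ := ih
      obtain ⟨w, hw, hw'⟩ := hP3.2 s hs (List.replicate _ a) (List.length_replicate ..) z hz
      refine ⟨w, hw, ?_⟩
      rw [nestedMul_replicate] at hw'
      rw [mul_add, mul_one, add_comm, Lpow_add, hz', Lpow_nsmul, hw', pow_succ, mul_smul]
  obtain ⟨z, hz, hz'⟩ := key s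
  have hz : p ^ s • z = 0 := hz
  rw [← Nat.sub_add_cancel hm, Lpow_add, hz', hz, Lpow_zero_right]

theorem pow_smul_iterate_eq {p : ℕ} {ρ : A → A} (hρ1 : ∀ x : A, x ∈ pA p 1 → p • ρ x = x)
    (hρ2 : ∀ i : ℕ, 1 ≤ i → ∀ x : A, x ∈ pA p i → ρ x ∈ pA p (i - 1)) {s : ℕ} {x : A}
    (hx : x ∈ pA p s) : p ^ s • ρ^[s] x = x := by
  induction s generalizing x with
  | zero => simp
  | succ s ih =>
    have h1 : x ∈ pA p 1 := by
      obtain ⟨y, rfl⟩ := hx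
      exact ⟨p ^ s • y, by simp [pow_succ', mul_smul]⟩
    rw [Function.iterate_succ_apply, pow_succ', mul_smul, ih (hρ2 (s + 1) (by omega) x hx),
      hρ1 x h1]

theorem sub_one_mul_sVal_le {p : ℕ} (hp : p.Prime) (j : ℕ) : (p - 1) * sVal p j ≤ j := by
  have := Fact.mk hp
  rw [sVal, Nat.factorization_def _ hp, sub_one_mul_padicValNat_factorial]
  exact Nat.sub_le _ _

theorem four_mul_etaVal_le {p : ℕ} (hp : p.Prime) (j : ℕ) : 4 * etaVal p j ≤ j := by
  refine le_trans ?_ (sub_one_mul_sVal_le hp j)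
  rw [etaVal, ← mul_assoc]
  exact Nat.mul_le_mul_right _ (Nat.mul_div_le _ _)

theorem exists_Lpow_eq_add (b d : A) (q : ℕ) {k : ℕ} {x y : A} (hx : x ∈ nestedPow A k)
    (hy : y ∈ nestedPow A k) (m : ℕ) : ∃ z ∈ nestedPow A (k + m),
      Lpow (b + q • d) m (x + q • y) = Lpow b m x + q • z := by
  induction m with
  | zero => exact ⟨y, hy, rfl⟩
  | succ m ih =>
    obtain ⟨z, hz, h⟩ := ih
    refine ⟨mul b z + mul d (Lpow b m x) + q • mul d z,
      add_mem (add_mem (mul_mem_nestedPow _ hz)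
        (mul_mem_nestedPow _ (Lpow_mem_nestedPow b m hx)))
        (nsmul_mem (mul_mem_nestedPow _ hz) _), ?_⟩
    rw [Lpow_succ, Lpow_succ, h, add_mul', mul_add', mul_add', mul_nsmul', mul_nsmul',
      nsmul_mul', nsmul_mul']
    module

theorem exists_Ediag_eq_add {p : ℕ} (hp : p.Prime) (hc0 : 0 < (p - 1) / 4)
    (hP3 : Property3 p A) {ρ : A → A} (hρ1 : ∀ x : A, x ∈ pA p 1 → p • ρ x = x)
    (hρ2 : ∀ i : ℕ, 1 ≤ i → ∀ x : A, x ∈ pA p i → ρ x ∈ pA p (i - 1)) {j : ℕ}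
    (hj : (p - 1) / 4 ≤ j) (b d : A) (q : ℕ) : ∃ z ∈ nestedPow A ((p - 1) / 4),
      Ediag p ρ (b + q • d) j = Ediag p ρ b j + q • z := by
  have hcA : nestedPow A ((p - 1) / 4) ≤ pSubgroup A p 1 := nestedPow_le hP3.1
  have hj0 : j ≠ 0 := by omega
  unfold Ediag
  rw [if_neg hj0, if_neg hj0]
  split_ifs with hη
  · obtain ⟨z, hz, h⟩ := exists_Lpow_eq_add b d q (mem_nestedPow_one b) (mem_nestedPow_one d)
      (j - 1)
    exact ⟨z, nestedPow_le_of_le hc0 (by omega) hz, h⟩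
  · have h4 := four_mul_etaVal_le hp j
    obtain ⟨Y, hY, h⟩ := exists_Lpow_eq_add b d q (mem_nestedPow_one b) (mem_nestedPow_one d)
      (etaVal p j - 1)
    set X := Lpow b (etaVal p j - 1) b
    have hX : X ∈ pA p (sVal p j) := nestedPow_le_pSubgroup hc0 hcA
      (k := sVal p j) (m := 1 + (etaVal p j - 1)) (by unfold etaVal at *; omega)
      (Lpow_mem_nestedPow b _ (mem_nestedPow_one b))
    have hYp : Y ∈ pSubgroup A p (sVal p j) := nestedPow_le_pSubgroup hc0 hcA
      (by unfold etaVal at *; omega) hY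
    have hXY : X + q • Y ∈ pA p (sVal p j) :=
      add_mem (S := AddSubgroup A) (s := pSubgroup A p (sVal p j)) hX (nsmul_mem hYp q)
    obtain ⟨z, hz : p ^ sVal p j • z = Y⟩ := hYp
    rw [h]
    have h1 := pow_smul_iterate_eq hρ1 hρ2 hX
    have h2 := pow_smul_iterate_eq hρ1 hρ2 hXY
    set x := ρ^[sVal p j] X
    set x' := ρ^[sVal p j] (X + q • Y)
    have hann : x' - (x + q • z) ∈ ann p (sVal p j) := by
      change p ^ sVal p j • (x' - (x + q • z)) = 0
      rw [smul_sub, smul_add, h1, h2, smul_comm, hz, sub_self]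
    obtain ⟨w, hw, h3⟩ := exists_Lpow_eq_add b d q (mem_nestedPow_one x) (mem_nestedPow_one z)
      (j - etaVal p j)
    have hηc : (p - 1) / 4 ≤ etaVal p j :=
      Nat.le_mul_of_pos_right _ (Nat.pos_of_ne_zero fun h0 => hη (by rw [etaVal, h0, mul_zero]))
    refine ⟨w, nestedPow_le_of_le hc0 (by omega) hw, ?_⟩
    rw [← h3, ← sub_add_cancel x' (x + q • z), Lpow_add_right,
      Lpow_eq_zero_of_mem_ann hP3 (by unfold etaVal at *; omega) _ hann, zero_add]

theorem Ediag_eq_zero {p n : ℕ} (hp : p.Prime) (hc0 : 0 < (p - 1) / 4) (hP3 : Property3 p A)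
    (hn : ∀ x : A, p ^ n • x = 0) (ρ : A → A) (a : A) {j : ℕ}
    (hj : 2 * ((p - 1) / 4 * n) + 2 ≤ j) : Ediag p ρ a j = 0 := by
  have hcA : nestedPow A ((p - 1) / 4) ≤ pSubgroup A p 1 := nestedPow_le hP3.1
  have h4 := four_mul_etaVal_le hp j
  have key {m : ℕ} (hm : (p - 1) / 4 * n ≤ m) (x : A) : Lpow a m x = 0 := by
    obtain ⟨y, hy : p ^ n • y = _⟩ := nestedPow_le_pSubgroup hc0 hcA (k := n) (by omega)
      (Lpow_mem_nestedPow a m (mem_nestedPow_one x))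
    rw [← hy, hn]
  unfold Ediag
  split_ifs
  · rfl
  · exact key (by omega) _
  · exact key (by omega) _

open Finset in
theorem Wmap_eq_sum {p n : ℕ} (hp : p.Prime) (hc0 : 0 < (p - 1) / 4) (hP3 : Property3 p A)
    (hn : ∀ x : A, p ^ n • x = 0) (σ : ℕ → ℤ) (ρ : A → A) (a : A) :
    Wmap p σ ρ a = ∑ j ∈ range ((p - 1) / 4 + (2 * ((p - 1) / 4 * n) + 2)),
      σ j • Ediag p ρ a j := by
  refine finsum_eq_sum_of_support_subset _ fun j hj => ?_
  by_contra h
  refine hj ?_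
  rw [coe_range, Set.mem_Iio] at h
  change σ j • Ediag p ρ a j = 0
  rw [Ediag_eq_zero hp hc0 hP3 hn ρ a (by omega), smul_zero]

open Finset in
/-- The map `W` separates points congruent modulo `p ^ i` but not modulo `p ^ (i + 1)`. -/
theorem pow_smul_mem_of_Wmap_eq {p n : ℕ} (hp : p.Prime) (hn0 : n ≠ 0)
    (hc0 : 0 < (p - 1) / 4) (hP3 : Property3 p A) (hn : ∀ x : A, p ^ n • x = 0)
    {ρ : A → A} (hρ1 : ∀ x : A, x ∈ pA p 1 → p • ρ x = x)
    (hρ2 : ∀ i : ℕ, 1 ≤ i → ∀ x : A, x ∈ pA p i → ρ x ∈ pA p (i - 1)) {σ : ℕ → ℤ}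
    (hσ : ∀ j : ℕ, 1 ≤ j →
      (p : ℤ) ^ n ∣ σ j * ((Nat.factorial j / p ^ sVal p j : ℕ) : ℤ) - 1)
    {b d : A} {i : ℕ} (h : Wmap p σ ρ (b + p ^ i • d) = Wmap p σ ρ b) :
    p ^ i • d ∈ pSubgroup A p (i + 1) := by
  have hcA : nestedPow A ((p - 1) / 4) ≤ pSubgroup A p 1 := nestedPow_le hP3.1
  have hs {j : ℕ} (hj : j < (p - 1) / 4) : sVal p j = 0 := by
    by_contra h0
    have h1 := sub_one_mul_sVal_le hp j
    have h2 := Nat.le_mul_of_pos_right (p - 1) (Nat.pos_of_ne_zero h0)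
    omega
  refine pow_smul_mem_of_sum_Lpow_sub_mem hp hcA hc0 (by omega) (σ := σ) (b := b)
    (fun j hj hjc => ?_) ?_
  · have h1 := (dvd_pow_self (p : ℤ) hn0).trans (hσ j hj)
    rwa [hs hjc, pow_zero, Nat.div_one] at h1
  · rw [Wmap_eq_sum hp hc0 hP3 hn, Wmap_eq_sum hp hc0 hP3 hn, ← sub_eq_zero,
      ← sum_sub_distrib, sum_range_add] at h
    have htail := sum_mem fun x (_ : x ∈ range (2 * ((p - 1) / 4 * n) + 2)) => by
      obtain ⟨z, hz, hz'⟩ := exists_Ediag_eq_add hp hc0 hP3 hρ1 hρ2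
        (Nat.le_add_right ((p - 1) / 4) x) b d (p ^ i)
      have := zsmul_mem (pow_smul_mem_pSubgroup i (hcA hz)) (σ ((p - 1) / 4 + x))
      rwa [← add_sub_cancel_left (Ediag p ρ b ((p - 1) / 4 + x)) (p ^ i • z), ← hz',
        smul_sub] at this
    have hhead := neg_mem htail
    rw [← eq_neg_of_add_eq_zero_left h, ← Nat.sub_add_cancel hc0, sum_range_succ'] at hhead
    have h0 (a : A) : Ediag p ρ a 0 = 0 := if_pos rfl
    rw [h0, h0, sub_self, add_zero] at hhead
    convert hhead using 1
    refine sum_congr rfl fun j hj => ?_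
    have hη : etaVal p (j + 1) = 0 := by
      rw [etaVal, hs (by have := mem_range.1 hj; omega), mul_zero]
    have hE (a : A) : Ediag p ρ a (j + 1) = Lpow a j a := by
      rw [Ediag, if_neg j.succ_ne_zero, if_pos hη, Nat.add_sub_cancel]
    rw [hE, hE, smul_sub]

end PreLieRing

open Function in
theorem Function.Bijective.iterate_card_factorial_sub_one {α : Type*} [Fintype α] {f : α → α}
    (hf : Bijective f) {N : ℕ} (hN : Fintype.card α ≤ N) (a : α) :
    f (f^[N.factorial - 1] a) = a ∧ f^[N.factorial - 1] (f a) = a := by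
  classical
  have h1 : Equiv.ofBijective f hf ^ N.factorial = 1 := by
    obtain ⟨k, hk⟩ := Nat.factorial_dvd_factorial hN
    rw [hk, pow_mul, ← Fintype.card_perm, pow_card_eq_one, one_pow]
  have h2 : f^[N.factorial] a = a := by
    have := DFunLike.congr_fun h1 a
    rwa [Equiv.Perm.coe_pow] at this
  rw [← iterate_succ_apply' f, ← iterate_succ_apply f, Nat.succ_eq_add_one,
    Nat.sub_add_cancel (Nat.factorial_pos N)]
  exact ⟨h2, h2⟩

open PreLieRing

theorem statement17 {A : Type*} [PreLieRing A] [Fintype A] (p n : ℕ) (hp : p.Prime)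
    (hp3 : 3 < p) (hcard : Fintype.card A = p ^ n) (hP3 : Property3 p A)
    (ρ : A → A) (hρ1 : ∀ x : A, x ∈ pA p 1 → p • ρ x = x)
    (hρ2 : ∀ i : ℕ, 1 ≤ i → ∀ x : A, x ∈ pA p i → ρ x ∈ pA p (i - 1))
    (σ : ℕ → ℤ)
    (hσ : ∀ j : ℕ, 1 ≤ j →
      (p : ℤ) ^ n ∣ σ j * ((Nat.factorial j / p ^ sVal p j : ℕ) : ℤ) - 1) :
    Function.Injective (Wmap p σ ρ : A → A) ∧
    Function.Bijective (Wmap p σ ρ : A → A) ∧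
    (∀ a : A,
      Wmap p σ ρ ((Wmap p σ ρ)^[Nat.factorial (p ^ (n + 1)) - 1] a) = a ∧
      (Wmap p σ ρ)^[Nat.factorial (p ^ (n + 1)) - 1] (Wmap p σ ρ a) = a) := by
  have hc0 : 0 < (p - 1) / 4 := by
    have : p ≠ 4 := fun h => by norm_num [h] at hp
    omega
  have hn : ∀ x : A, p ^ n • x = 0 := fun x => by rw [← hcard, card_nsmul_eq_zero]
  have hinj : Function.Injective (Wmap p σ ρ : A → A) := by
    rcases eq_or_ne n 0 with rfl | hn0
    · have : Subsingleton A := Fintype.card_le_one_iff_subsingleton.1 (by rw [hcard, pow_zero])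
      exact Function.injective_of_subsingleton _
    intro a b hab
    have key (i : ℕ) : a - b ∈ pSubgroup A p i := by
      induction i with
      | zero => exact ⟨a - b, by simp⟩
      | succ i ih =>
        obtain ⟨d, hd : p ^ i • d = a - b⟩ := ih
        rw [← hd]
        refine pow_smul_mem_of_Wmap_eq hp hn0 hc0 hP3 hn hρ1 hρ2 hσ (b := b) ?_
        rw [hd, add_sub_cancel, hab]
    obtain ⟨d, hd : p ^ n • d = a - b⟩ := key n
    exact sub_eq_zero.1 (hd.symm.trans (hn d))
  have hbij := Finite.injective_iff_bijective.1 hinj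
  exact ⟨hinj, hbij, fun a => hbij.iterate_card_factorial_sub_one
    (hcard.le.trans (Nat.pow_le_pow_right hp.pos n.le_succ)) a⟩
end
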